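/- arXiv:1001.4674 — 4 statements merged into one kernel-verified Lean document; each statement's English description precedes it below -/
import Mathlib

section
/- Resampling after an adaptive exploration preserves the percolation measure: Let E be the edge set of the grid graph on ℤ² (vertices ℤ², edges between vertices at ℓ¹-distance 1), let Ω = {0,1}^E with the product σ-algebra, and let Pr be the product measure on Ω under which each coordinate equals 1 with probability 1/2, independently. For v ∈ ℤ², a translation acts on E by translating both endpoints of an edge. Let S : Ω → {finite subsets of E} be a measurable map with the property that whenever ω, ω' ∈ Ω agree on every edge of S(ω), then S(ω') = S(ω). Let ν be any probability measure on ℤ², and define f : Ω × Ω × ℤ² → Ω by f(ω_1, ω_2, v)(e) = ω_1(e) if e ∈ S(ω_1), and f(ω_1, ω_2, v)(e) = ω_2(e − v) otherwise. Then f is measurable, and the pushforward of the product measure Pr ⊗ Pr ⊗ ν under f equals Pr. -/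
open MeasureTheory

/-- A bond of the grid `ℤ²`: `(v, true)` is the bond joining `v` to `v + (1,0)`,
and `(v, false)` is the bond joining `v` to `v + (0,1)`. -/
abbrev GridBond : Type := (ℤ × ℤ) × Bool

/-- A percolation configuration: each bond is open (`true`) or closed (`false`). -/
abbrev PercCfg : Type := GridBond → Bool

open Set

/-- A measure is the sum of its restrictions to the fibres of a countably valued map. -/
theorem measure_eq_tsum_inter_fiber {α β : Type*} [MeasurableSpace α] [Countable β]
    (μ : Measure α) (g : α → β) (hg : ∀ b, MeasurableSet (g ⁻¹' {b})) (A : Set α) :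
    μ A = ∑' b, μ (A ∩ g ⁻¹' {b}) := by
  have h := tsum_measure_preimage_singleton (μ := μ.restrict A) (f := g) countable_univ
    (fun b _ => hg b)
  rw [preimage_univ, Measure.restrict_apply_univ,
    tsum_univ (fun b => μ.restrict A (g ⁻¹' {b}))] at h
  rw [← h]
  exact tsum_congr fun b => by rw [Measure.restrict_apply (hg b), inter_comm]

theorem measurableSet_setOf_forall_mem_finset_eq {ι : Type*} (s : Finset ι) (f : ι → Bool) :
    MeasurableSet {ω : ι → Bool | ∀ e ∈ s, ω e = f e} := by
  simp only [ofPred_forall]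
  exact s.measurableSet_biInter fun e _ =>
    (measurable_pi_apply e : Measurable fun ω : ι → Bool => ω e) (measurableSet_singleton (f e))

/-- Finite measures on `ι → Bool` that agree on cylinders are equal. -/
theorem ext_of_forall_cylinder {ι : Type*} (μ ν : Measure (ι → Bool)) [IsFiniteMeasure μ]
    (h : ∀ (s : Finset ι) (f : ι → Bool),
      μ {ω | ∀ e ∈ s, ω e = f e} = ν {ω | ∀ e ∈ s, ω e = f e}) : μ = ν := by
  classical
  refine ext_of_generate_finite
    {A | ∃ (s : Finset ι) (f : ι → Bool), A = {ω | ∀ e ∈ s, ω e = f e}} ?_ ?_ ?_ ?_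
  · refine le_antisymm ?_ (MeasurableSpace.generateFrom_le ?_)
    · refine iSup_le fun i => ?_
      rw [← measurable_iff_comap_le]
      refine measurable_to_bool (MeasurableSpace.measurableSet_generateFrom
        ⟨{i}, fun _ => true, ?_⟩)
      ext ω
      simp
    · rintro A ⟨s, f, rfl⟩
      exact measurableSet_setOf_forall_mem_finset_eq s f
  · rintro A ⟨s, f, rfl⟩ B ⟨t, g, rfl⟩ ⟨η, hs, ht⟩
    refine ⟨s ∪ t, η, ?_⟩
    ext ω
    simp only [mem_inter_iff, mem_ofPred_eq, Finset.mem_union] at hs ht ⊢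
    grind
  · rintro A ⟨s, f, rfl⟩
    exact h s f
  · simpa using h ∅ fun _ => true

/-- Under a fair product measure, an event determined by the coordinates in `T` is independent of
any cylinder over a finite set disjoint from `T`. -/
theorem measure_inter_cylinder_of_determined {ι : Type*} (μ : Measure (ι → Bool))
    (hcyl : ∀ (s : Finset ι) (f : ι → Bool),
      μ {ω | ∀ e ∈ s, ω e = f e} = (1 / 2 : ENNReal) ^ s.card)
    (T u : Finset ι) (hTu : Disjoint T u) (A : Set (ι → Bool))
    (hA : ∀ ω ω' : ι → Bool, (∀ e ∈ T, ω' e = ω e) → ω ∈ A → ω' ∈ A) (f : ι → Bool) :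
    μ (A ∩ {ω | ∀ e ∈ u, ω e = f e}) = μ A * (1 / 2 : ENNReal) ^ u.card := by
  classical
  let r : (ι → Bool) → T → Bool := T.restrict
  have hfib (ω₀ : ι → Bool) : r ⁻¹' {r ω₀} = {ω | ∀ e ∈ T, ω e = ω₀ e} := by
    ext ω
    simp [r, funext_iff]
  have hsurj (b : T → Bool) : ∃ ω₀ : ι → Bool, r ω₀ = b :=
    ⟨fun i => if h : i ∈ T then b ⟨i, h⟩ else true, by ext i; simp [r]⟩
  have hmeas (b : T → Bool) : MeasurableSet (r ⁻¹' {b} : Set (ι → Bool)) := by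
    obtain ⟨ω₀, rfl⟩ := hsurj b
    rw [hfib]
    exact measurableSet_setOf_forall_mem_finset_eq T ω₀
  rw [measure_eq_tsum_inter_fiber μ r hmeas,
    measure_eq_tsum_inter_fiber μ r hmeas A, ← ENNReal.tsum_mul_right]
  refine tsum_congr fun b => ?_
  obtain ⟨ω₀, rfl⟩ := hsurj b
  rw [hfib]
  by_cases h₀ : ω₀ ∈ A
  · have h₁ : A ∩ {ω | ∀ e ∈ T, ω e = ω₀ e} = {ω | ∀ e ∈ T, ω e = ω₀ e} :=
      inter_eq_right.2 fun ω hω => hA ω₀ ω hω h₀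
    have h₂ : {ω : ι → Bool | ∀ e ∈ T, ω e = ω₀ e} ∩ {ω | ∀ e ∈ u, ω e = f e} =
        {ω | ∀ e ∈ T ∪ u, ω e = if e ∈ T then ω₀ e else f e} := by
      ext ω
      have := Finset.disjoint_left.1 hTu
      simp only [mem_inter_iff, mem_ofPred_eq, Finset.mem_union]
      grind
    rw [inter_right_comm, h₁, h₂, hcyl, hcyl, Finset.card_union_of_disjoint hTu, pow_add]
  · have h₁ : A ∩ {ω | ∀ e ∈ T, ω e = ω₀ e} = ∅ :=
      eq_empty_of_forall_notMem fun ω hω => h₀ (hA ω ω₀ (fun e he => (hω.2 e he).symm) hω.1)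
    rw [inter_right_comm, h₁, empty_inter, measure_empty, zero_mul]

theorem measurable_translated_coordinate (e : GridBond) :
    Measurable fun y : PercCfg × (ℤ × ℤ) => y.1 (e.1 - y.2, e.2) :=
  measurable_from_prod_countable_left fun v => measurable_pi_apply (e.1 - v, e.2)

/-- Translating a fair configuration by an independent random vector preserves the probability
of cylinders. -/
theorem measure_translated_cylinder (μ : Measure PercCfg) [SFinite μ]
    (hcyl : ∀ (s : Finset GridBond) (f : GridBond → Bool),
      μ {ω | ∀ e ∈ s, ω e = f e} = (1 / 2 : ENNReal) ^ s.card)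
    (ν : Measure (ℤ × ℤ)) [IsProbabilityMeasure ν] (u : Finset GridBond) (f : GridBond → Bool) :
    (μ.prod ν) {y | ∀ e ∈ u, y.1 (e.1 - y.2, e.2) = f e} = (1 / 2 : ENNReal) ^ u.card := by
  classical
  have hm : MeasurableSet
      {y : PercCfg × (ℤ × ℤ) | ∀ e ∈ u, y.1 (e.1 - y.2, e.2) = f e} := by
    simp only [ofPred_forall]
    exact u.measurableSet_biInter fun e _ =>
      measurable_translated_coordinate e (measurableSet_singleton (f e))
  have hslice (v : ℤ × ℤ) :
      μ ((fun ω => (ω, v)) ⁻¹' {y | ∀ e ∈ u, y.1 (e.1 - y.2, e.2) = f e}) =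
        (1 / 2 : ENNReal) ^ u.card := by
    have hinj : Function.Injective fun e : GridBond => ((e.1 - v, e.2) : GridBond) := by
      rintro ⟨a, b⟩ ⟨c, d⟩ h
      simpa using h
    rw [← Finset.card_image_of_injective u hinj, ← hcyl _ fun e => f (e.1 + v, e.2)]
    congr 1
    ext ω
    simp only [mem_preimage, mem_ofPred_eq, Finset.forall_mem_image, sub_add_cancel]
  rw [Measure.prod_apply_symm hm]
  simp only [hslice, lintegral_const, measure_univ, mul_one]


/-- **Resampling after an adaptive exploration preserves the percolation
measure**: if `Pr` is the i.i.d. Bernoulli(1/2) bond measure, `S` is a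
measurable exploration (`S ω` is determined by the states of the bonds in
`S ω`), and `ν` is any probability measure on `ℤ²`, then the map
`f(ω₁, ω₂, v)(e) = ω₁(e)` for `e ∈ S(ω₁)` and `ω₂(e - v)` otherwise is
measurable and pushes `Pr ⊗ Pr ⊗ ν` forward to `Pr`. -/
theorem resampling_preserves_measure (Pr : Measure PercCfg)
    (hPr : IsProbabilityMeasure Pr)
    (hcyl : ∀ (s : Finset GridBond) (f : GridBond → Bool),
      Pr {ω | ∀ e ∈ s, ω e = f e} = (1 / 2 : ENNReal) ^ s.card)
    (S : PercCfg → Finset GridBond)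
    (hSmeas : ∀ A : Set (Finset GridBond), MeasurableSet (S ⁻¹' A))
    (hSlocal : ∀ ω ω' : PercCfg, (∀ e ∈ S ω, ω' e = ω e) → S ω' = S ω)
    (ν : Measure (ℤ × ℤ)) (hν : IsProbabilityMeasure ν) :
    Measurable (fun x : PercCfg × PercCfg × (ℤ × ℤ) => fun e : GridBond =>
        if e ∈ S x.1 then x.1 e else x.2.1 (e.1 - x.2.2, e.2)) ∧
    Measure.map (fun x : PercCfg × PercCfg × (ℤ × ℤ) => fun e : GridBond =>
        if e ∈ S x.1 then x.1 e else x.2.1 (e.1 - x.2.2, e.2))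
      (Pr.prod (Pr.prod ν)) = Pr := by
  classical
  have hF : Measurable (fun x : PercCfg × PercCfg × (ℤ × ℤ) => fun e : GridBond =>
      if e ∈ S x.1 then x.1 e else x.2.1 (e.1 - x.2.2, e.2)) := by
    refine measurable_pi_iff.2 fun e => Measurable.ite ?_ ?_ ?_
    · exact measurable_fst (hSmeas {T | e ∈ T})
    · exact (measurable_pi_apply e).comp measurable_fst
    · exact (measurable_translated_coordinate e).comp measurable_snd
  refine ⟨hF, ?_⟩
  have := Measure.isProbabilityMeasure_map (μ := Pr.prod (Pr.prod ν)) hF.aemeasurable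
  refine ext_of_forall_cylinder _ _ fun s f => ?_
  rw [Measure.map_apply hF (measurableSet_setOf_forall_mem_finset_eq s f),
    measure_eq_tsum_inter_fiber _ (fun x : PercCfg × PercCfg × (ℤ × ℤ) => S x.1)
      (fun T => measurable_fst (hSmeas {T})),
    measure_eq_tsum_inter_fiber Pr S (fun T => hSmeas {T})]
  refine tsum_congr fun T => ?_
  set A : Set PercCfg := {ω | S ω = T ∧ ∀ e ∈ s ∩ T, ω e = f e} with hA
  have hprod : ((fun x : PercCfg × PercCfg × (ℤ × ℤ) => fun e : GridBond =>
        if e ∈ S x.1 then x.1 e else x.2.1 (e.1 - x.2.2, e.2)) ⁻¹'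
          {ω | ∀ e ∈ s, ω e = f e}) ∩ (fun x => S x.1) ⁻¹' {T} =
      A ×ˢ {y | ∀ e ∈ s \ T, y.1 (e.1 - y.2, e.2) = f e} := by
    ext ⟨ω, η, v⟩
    simp only [hA, mem_inter_iff, mem_preimage, mem_ofPred_eq, mem_singleton_iff, mem_prod,
      Finset.mem_inter, Finset.mem_sdiff]
    grind
  have hsplit : {ω | ∀ e ∈ s, ω e = f e} ∩ S ⁻¹' {T} =
      A ∩ {ω | ∀ e ∈ s \ T, ω e = f e} := by
    ext ω
    simp only [hA, mem_inter_iff, mem_preimage, mem_ofPred_eq, mem_singleton_iff,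
      Finset.mem_inter, Finset.mem_sdiff]
    grind
  have hdet (ω ω' : PercCfg) (h : ∀ e ∈ T, ω' e = ω e) (hω : ω ∈ A) : ω' ∈ A := by
    obtain ⟨hS, hf⟩ := hω
    refine ⟨(hSlocal ω ω' (by rwa [hS])).trans hS, fun e he => ?_⟩
    rw [h e (Finset.mem_inter.1 he).2, hf e he]
  rw [hprod, hsplit, Measure.prod_prod, measure_translated_cylinder Pr hcyl ν,
    measure_inter_cylinder_of_determined Pr hcyl T (s \ T) Finset.disjoint_sdiff A hdet f]
end

section
/- Margulis–Russo-type inequality for products of posets: Let P be a finite poset, and let μ_0, μ_1 be probability measures on P such that μ_1 strictly dominates μ_0, i.e. μ_1(U) > μ_0(U) for every nontrivial upset U of P. Let c_0 be the minimum of μ_1(U) − μ_0(U) over all nontrivial upsets U, so c_0 > 0. For h ∈ ℝ let μ_h = (1−h)μ_0 + h·μ_1 (a probability measure for h ∈ [0,1]), and for n ≥ 1 let μ_h^n denote the induced product measure on P^n. Let A be an upset in P^n. For ω ∈ P^n, call a coordinate i pivotal for A in ω if there exist x, y ∈ P such that the configuration obtained from ω by replacing its i-th coordinate with x lies in A while the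 one obtained by replacing it with y does not; let N(ω) be the number of pivotal coordinates. Then the function g(h) = μ_h^n(A) (a polynomial in h) satisfies, for every h ∈ [0,1], g'(h) ≥ c_0 · E_{μ_h^n}[N]. -/
/-- If `ν` has total mass zero and gives mass at least `c` to every nontrivial upper set, then its
mass on an upper set `U` is at least `c` or `0`, according to whether `U` is nontrivial. -/
theorem ite_le_sum_indicator_of_isUpperSet {P : Type*} [Fintype P] [Preorder P] (ν : P → ℝ) (c : ℝ)
    (hν : ∑ x, ν x = 0)
    (hc : ∀ U : Set P, IsUpperSet U → U ≠ ∅ → U ≠ Set.univ → c ≤ ∑ x, U.indicator ν x)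
    (U : Set P) (hU : IsUpperSet U) [Decidable (∃ x y, x ∈ U ∧ y ∉ U)] :
    (if ∃ x y, x ∈ U ∧ y ∉ U then c else 0) ≤ ∑ x, U.indicator ν x := by
  split_ifs with hp
  · obtain ⟨x, y, hx, hy⟩ := hp
    refine hc U hU (fun h0 => ?_) (fun h1 => ?_)
    · simp [h0] at hx
    · simp [h1] at hy
  · by_cases h0 : U = ∅
    · simp [h0]
    · obtain ⟨x, hx⟩ := Set.nonempty_iff_ne_empty.2 h0
      have h1 : U = Set.univ := Set.eq_univ_of_forall fun y => by
        by_contra hy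
        exact hp ⟨x, y, hx, hy⟩
      simp [h1, hν]

/-- The contribution of a single coordinate `i` to the Margulis–Russo inequality. -/
theorem mul_sum_pivotal_le {P : Type*} [Fintype P] [Preorder P] {m : ℕ} (μ ν : P → ℝ) (c : ℝ)
    (hμ0 : ∀ x, 0 ≤ μ x) (hμ1 : ∑ x, μ x = 1) (hν : ∑ x, ν x = 0)
    (hc : ∀ U : Set P, IsUpperSet U → U ≠ ∅ → U ≠ Set.univ → c ≤ ∑ x, U.indicator ν x)
    (A : Set (Fin (m + 1) → P)) (hA : IsUpperSet A) (i : Fin (m + 1))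
    [∀ ω : Fin (m + 1) → P,
      Decidable (∃ x y, Function.update ω i x ∈ A ∧ Function.update ω i y ∉ A)] :
    c * ∑ ω : Fin (m + 1) → P, (∏ j, μ (ω j)) *
        (if ∃ x y, Function.update ω i x ∈ A ∧ Function.update ω i y ∉ A then 1 else 0) ≤
      ∑ ω : Fin (m + 1) → P,
        A.indicator (fun ω => (∏ j ∈ Finset.univ.erase i, μ (ω j)) * ν (ω i)) ω := by
  classical
  have herase (ω : Fin (m + 1) → P) :
      ∏ j ∈ Finset.univ.erase i, μ (ω j) = ∏ j, μ (ω (i.succAbove j)) := by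
    have hi : Finset.univ.erase i = Finset.univ.map i.succAboveEmb := by
      ext j
      simp [Fin.exists_succAbove_eq_iff]
    rw [hi, Finset.prod_map]
    rfl
  rw [← (Fin.insertNthEquiv (fun _ => P) i).sum_comp, ← (Fin.insertNthEquiv (fun _ => P) i).sum_comp,
    Fintype.sum_prod_type_right, Fintype.sum_prod_type_right, Finset.mul_sum]
  refine Finset.sum_le_sum fun p _ => ?_
  have hU : IsUpperSet {x | i.insertNth (α := fun _ => P) x p ∈ A} := fun x y hxy hx =>
    hA (Fin.insertNth_le_iff.2 ⟨by simpa using hxy, fun j => by simp⟩) hx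
  have key := mul_le_mul_of_nonneg_left (ite_le_sum_indicator_of_isUpperSet ν c hν hc _ hU)
    (Finset.prod_nonneg fun j (_ : j ∈ Finset.univ) => hμ0 (p j))
  have hins (x : P) : Fin.insertNthEquiv (fun _ => P) i (x, p) = i.insertNth x p := rfl
  simp only [hins, Fin.update_insertNth, Fin.prod_univ_succAbove _ i,
    Fin.insertNth_apply_same, Fin.insertNth_apply_succAbove, herase, Set.indicator_apply,
    Set.mem_ofPred_eq] at key ⊢
  calc _ = (∏ j, μ (p j)) * (if ∃ x y, i.insertNth (α := fun _ => P) x p ∈ A ∧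
          i.insertNth (α := fun _ => P) y p ∉ A then c else 0) := by
        by_cases hp : ∃ x y, i.insertNth (α := fun _ => P) x p ∈ A ∧
          i.insertNth (α := fun _ => P) y p ∉ A
        · simp only [hp, if_true, mul_one, ← Finset.sum_mul, hμ1, one_mul, mul_comm c]
        · simp only [hp, if_false, mul_zero, Finset.sum_const_zero]
    _ ≤ _ := key
    _ = _ := by
        rw [Finset.mul_sum]
        simp

/-- **Margulis–Russo-type inequality for products of posets**: if `μ₁` strictly
dominates `μ₀` on a finite poset `P`, `c₀` is the minimum of `μ₁(U) − μ₀(U)`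
over nontrivial upsets `U`, `μ_h = (1−h)μ₀ + hμ₁`, and `A` is an upset in
`P^n`, then `d/dh μ_h^n(A) ≥ c₀ · E_{μ_h^n}[N]`, where `N(ω)` is the number of
pivotal coordinates for `A` in `ω`. -/
theorem margulis_russo_posets (P : Type) [Fintype P] [PartialOrder P]
    (μ0 μ1 : P → ℝ)
    (hμ00 : ∀ x, 0 ≤ μ0 x) (hμ01 : ∑ x : P, μ0 x = 1)
    (hμ10 : ∀ x, 0 ≤ μ1 x) (hμ11 : ∑ x : P, μ1 x = 1)
    (hdom : ∀ U : Set P, IsUpperSet U → U ≠ ∅ → U ≠ Set.univ →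
      (∑ x : P, U.indicator μ0 x) < (∑ x : P, U.indicator μ1 x))
    (c0 : ℝ)
    (hc0 : IsLeast {r : ℝ | ∃ U : Set P, IsUpperSet U ∧ U ≠ ∅ ∧ U ≠ Set.univ ∧
      r = (∑ x : P, U.indicator μ1 x) - (∑ x : P, U.indicator μ0 x)} c0)
    (n : ℕ) (hn : 1 ≤ n) (A : Set (Fin n → P)) (hA : IsUpperSet A)
    (h : ℝ) (hh : h ∈ Set.Icc (0 : ℝ) 1) :
    deriv (fun h' : ℝ => ∑ ω : Fin n → P,
        A.indicator (fun ω' => ∏ i, ((1 - h') * μ0 (ω' i) + h' * μ1 (ω' i))) ω) h ≥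
      c0 * ∑ ω : Fin n → P,
        (∏ i, ((1 - h) * μ0 (ω i) + h * μ1 (ω i))) *
          (Set.ncard {i : Fin n | ∃ x y : P,
              Function.update ω i x ∈ A ∧ Function.update ω i y ∉ A} : ℝ) := by
  classical
  obtain ⟨m, rfl⟩ : ∃ m, n = m + 1 := ⟨n - 1, by omega⟩
  set μ : P → ℝ := fun x => (1 - h) * μ0 x + h * μ1 x with hμ
  have hμ0 (x : P) : 0 ≤ μ x :=
    add_nonneg (mul_nonneg (by linarith [hh.2]) (hμ00 x)) (mul_nonneg hh.1 (hμ10 x))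
  have hμ1 : ∑ x, μ x = 1 := by
    simp only [hμ, Finset.sum_add_distrib, ← Finset.mul_sum, hμ01, hμ11]
    ring
  have hν : ∑ x, (μ1 x - μ0 x) = 0 := by
    rw [Finset.sum_sub_distrib, hμ01, hμ11, sub_self]
  have hc (U : Set P) (hU : IsUpperSet U) (h0 : U ≠ ∅) (h1 : U ≠ Set.univ) :
      c0 ≤ ∑ x, U.indicator (fun x => μ1 x - μ0 x) x := by
    refine hc0.2 ⟨U, hU, h0, h1, ?_⟩
    rw [← Finset.sum_sub_distrib]
    exact Finset.sum_congr rfl fun x _ => by simp only [Set.indicator_apply]; split_ifs <;> simp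
  have hderiv (ω : Fin (m + 1) → P) : HasDerivAt
      (fun h' : ℝ => A.indicator (fun ω' => ∏ i, ((1 - h') * μ0 (ω' i) + h' * μ1 (ω' i))) ω)
      (∑ i, A.indicator
        (fun ω => (∏ j ∈ Finset.univ.erase i, μ (ω j)) * (μ1 (ω i) - μ0 (ω i))) ω) h := by
    by_cases hω : ω ∈ A
    · simp only [Set.indicator_of_mem hω]
      refine HasDerivAt.fun_finsetProd fun i _ => ?_
      exact ((((hasDerivAt_id h).const_sub 1).mul_const (μ0 (ω i))).add
        ((hasDerivAt_id h).mul_const (μ1 (ω i)))).congr_deriv (by ring)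
    · simpa only [Set.indicator_of_notMem hω, Finset.sum_const_zero] using hasDerivAt_const h (0 : ℝ)
  have hcard (ω : Fin (m + 1) → P) :
      (Set.ncard {i | ∃ x y, Function.update ω i x ∈ A ∧ Function.update ω i y ∉ A} : ℝ) =
        ∑ i, if ∃ x y, Function.update ω i x ∈ A ∧ Function.update ω i y ∉ A
          then (1 : ℝ) else 0 := by
    rw [Set.ncard_eq_toFinset_card', Finset.sum_boole, Set.toFinset_ofPred]
  rw [(HasDerivAt.fun_sum fun ω _ => hderiv ω).deriv, ge_iff_le, Finset.sum_comm]
  simp only [hcard, Finset.mul_sum (s := (Finset.univ : Finset (Fin (m + 1))))]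
  rw [Finset.sum_comm, Finset.mul_sum]
  exact Finset.sum_le_sum fun i _ => mul_sum_pivotal_le μ _ c0 hμ0 hμ1 hν hc A hA i
end

section
/- Sharp-threshold theorem for symmetric upsets in powers of a poset (Theorem 6.2): Let P be a finite poset and let μ_0, μ_1 be probability measures on P such that μ_1 strictly dominates μ_0, i.e. μ_1(U) > μ_0(U) for every nontrivial upset U of P. Then there is a constant c_1 = c_1(μ_0, μ_1) > 0 with the following property. Let 0 < ε < 1/2, let n ≥ 1, and let A be an upset in P^n that is symmetric, i.e. there is a subgroup G of the symmetric group on {1, …, n} acting transitively on {1, …, n} such that A is invariant under the induced permutations of coordinates. If μ_0^n(A) > ε and c_1 · log n ≥ log(1/ε), then μ_1^n(A) > 1 − ε. -/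
namespace ProductThreshold

open Function

noncomputable section

variable {ι P : Type*}

section Weight

variable [Fintype ι]

/-- The weight of a point under the product of copies of `μ`. -/
def weight (μ : P → ℝ) (x : ι → P) : ℝ := ∏ i, μ (x i)

theorem weight_nonneg {μ : P → ℝ} (h0 : ∀ p, 0 ≤ μ p) (x : ι → P) : 0 ≤ weight μ x :=
  Finset.prod_nonneg fun _ _ => h0 _

variable [DecidableEq ι]

theorem weight_eq_mul (μ : P → ℝ) (i : ι) (x : ι → P) :
    weight μ x = μ (x i) * ∏ j ∈ Finset.univ.erase i, μ (x j) :=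
  (Finset.mul_prod_erase _ _ (Finset.mem_univ i)).symm

theorem prod_erase_update (μ : P → ℝ) (i : ι) (x : ι → P) (p : P) :
    ∏ j ∈ Finset.univ.erase i, μ (update x i p j) = ∏ j ∈ Finset.univ.erase i, μ (x j) := by
  refine Finset.prod_congr rfl fun j hj => ?_
  rw [update_of_ne (Finset.ne_of_mem_erase hj)]

theorem eq_of_forall_update {f : (ι → P) → ℝ} (h : ∀ i x p, f (update x i p) = f x)
    (x y : ι → P) : f x = f y := by
  have key : ∀ s : Finset ι, f (fun i => if i ∈ s then y i else x i) = f x := by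
    intro s
    induction s using Finset.induction_on with
    | empty => simp
    | insert a s _ ih =>
      rw [← ih, ← h a (fun i => if i ∈ s then y i else x i) (y a)]
      congr 1
      funext i
      rcases eq_or_ne i a with rfl | hi <;> simp [update_of_ne, *]
  simpa using (key Finset.univ).symm

end Weight

variable [DecidableEq ι] [Fintype P]

/-- Averaging over the coordinate `i`. -/
def avg (μ : P → ℝ) (i : ι) (f : (ι → P) → ℝ) : (ι → P) → ℝ :=
  fun x => ∑ p, μ p * f (update x i p)

/-- The fluctuation of `f` in the coordinate `i`. -/
def fluct (μ : P → ℝ) (i : ι) (f : (ι → P) → ℝ) : (ι → P) → ℝ :=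
  fun x => f x - avg μ i f x

/-- Averaging successively over the coordinates `e 0, …, e (k - 1)`. -/
def succAvg (μ : P → ℝ) (e : ℕ → ι) (f : (ι → P) → ℝ) : ℕ → (ι → P) → ℝ
  | 0 => f
  | k + 1 => avg μ (e k) (succAvg μ e f k)

/-- The martingale differences of the sequence `succAvg`. -/
def mdiff (μ : P → ℝ) (e : ℕ → ι) (f : (ι → P) → ℝ) (k : ℕ) : (ι → P) → ℝ :=
  fluct μ (e k) (succAvg μ e f k)

theorem avg_update (μ : P → ℝ) (i : ι) (f : (ι → P) → ℝ) (x : ι → P) (p : P) :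
    avg μ i f (update x i p) = avg μ i f x := by
  simp [avg]

theorem avg_avg {μ : P → ℝ} (h1 : ∑ p, μ p = 1) (i : ι) (f : (ι → P) → ℝ) :
    avg μ i (avg μ i f) = avg μ i f := by
  funext x
  conv_lhs => rw [avg]
  simp [avg_update, ← Finset.sum_mul, h1]

theorem avg_comm (μ : P → ℝ) (i j : ι) (f : (ι → P) → ℝ) :
    avg μ i (avg μ j f) = avg μ j (avg μ i f) := by
  rcases eq_or_ne i j with rfl | hij
  · rfl
  funext x
  simp only [avg, Finset.mul_sum]
  rw [Finset.sum_comm]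
  refine Finset.sum_congr rfl fun p _ => Finset.sum_congr rfl fun q _ => ?_
  rw [update_comm hij]
  ring

theorem avg_sub (μ : P → ℝ) (i : ι) (f g : (ι → P) → ℝ) :
    avg μ i (fun x => f x - g x) = fun x => avg μ i f x - avg μ i g x := by
  funext x
  simp [avg, mul_sub, Finset.sum_sub_distrib]

theorem avg_pos {μ : P → ℝ} (h0 : ∀ p, 0 ≤ μ p) (h1 : ∑ p, μ p = 1) (i : ι)
    {f : (ι → P) → ℝ} (hf : ∀ x, 0 < f x) (x : ι → P) : 0 < avg μ i f x := by
  have hnn : ∀ p ∈ Finset.univ, 0 ≤ μ p * f (update x i p) :=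
    fun p _ => mul_nonneg (h0 p) (hf _).le
  refine lt_of_le_of_ne (Finset.sum_nonneg hnn) fun h => ?_
  have hz := (Finset.sum_eq_zero_iff_of_nonneg hnn).1 h.symm
  have : ∑ p, μ p = 0 := Finset.sum_eq_zero fun p hp =>
    (mul_eq_zero.1 (hz p hp)).resolve_right (hf _).ne'
  linarith

theorem abs_avg_le {μ : P → ℝ} (h0 : ∀ p, 0 ≤ μ p) (i : ι) (f : (ι → P) → ℝ) (x : ι → P) :
    |avg μ i f x| ≤ avg μ i (fun y => |f y|) x := by
  refine (Finset.abs_sum_le_sum_abs _ _).trans (Finset.sum_le_sum fun p _ => ?_)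
  rw [abs_mul, abs_of_nonneg (h0 p)]

theorem succAvg_avg (μ : P → ℝ) (e : ℕ → ι) (i : ι) (f : (ι → P) → ℝ) (k : ℕ) :
    succAvg μ e (avg μ i f) k = avg μ i (succAvg μ e f k) := by
  induction k with
  | zero => rfl
  | succ k ih => rw [succAvg, succAvg, ih, avg_comm]

theorem succAvg_sub (μ : P → ℝ) (e : ℕ → ι) (f g : (ι → P) → ℝ) (k : ℕ) :
    succAvg μ e (fun x => f x - g x) k = fun x => succAvg μ e f k x - succAvg μ e g k x := by
  induction k with
  | zero => rfl
  | succ k ih => simp only [succAvg, ih, avg_sub]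

theorem succAvg_fluct (μ : P → ℝ) (e : ℕ → ι) (i : ι) (f : (ι → P) → ℝ) (k : ℕ) :
    succAvg μ e (fluct μ i f) k = fluct μ i (succAvg μ e f k) := by
  unfold fluct
  rw [succAvg_sub, succAvg_avg]

theorem fluct_comm (μ : P → ℝ) (i j : ι) (f : (ι → P) → ℝ) :
    fluct μ i (fluct μ j f) = fluct μ j (fluct μ i f) := by
  unfold fluct
  rw [avg_sub, avg_sub, avg_comm]
  funext x
  ring

theorem mdiff_fluct (μ : P → ℝ) (e : ℕ → ι) (i : ι) (f : (ι → P) → ℝ) (k : ℕ) :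
    mdiff μ e (fluct μ i f) k = fluct μ i (mdiff μ e f k) := by
  rw [mdiff, mdiff, succAvg_fluct, fluct_comm]

theorem avg_succAvg_of_lt {μ : P → ℝ} (h1 : ∑ p, μ p = 1) (e : ℕ → ι)
    (f : (ι → P) → ℝ) {j k : ℕ} (h : j < k) :
    avg μ (e j) (succAvg μ e f k) = succAvg μ e f k := by
  induction k with
  | zero => omega
  | succ k ih =>
    rcases Nat.lt_succ_iff_lt_or_eq.1 h with h | rfl
    · rw [succAvg, avg_comm, ih h]
    · rw [succAvg, avg_avg h1]

/-- The coordinate `i` is pivotal for `A` at `x` if changing it can alter membership in `A`. -/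
def IsPivotal (A : Set (ι → P)) (i : ι) (x : ι → P) : Prop :=
  ∃ p q, update x i p ∈ A ∧ update x i q ∉ A

theorem indicator_one_nonneg {α : Type*} (s : Set α) (x : α) : 0 ≤ s.indicator (1 : α → ℝ) x :=
  Set.indicator_nonneg (fun _ _ => zero_le_one) x

theorem indicator_one_le_one {α : Type*} (s : Set α) (x : α) : s.indicator (1 : α → ℝ) x ≤ 1 :=
  Set.indicator_le' (fun _ _ => le_rfl) (fun _ _ => zero_le_one) x

theorem abs_fluct_indicator_le {μ : P → ℝ} (h0 : ∀ p, 0 ≤ μ p) (h1 : ∑ p, μ p = 1)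
    (A : Set (ι → P)) (i : ι) (x : ι → P) :
    |fluct μ i (A.indicator 1) x| ≤ {x | IsPivotal A i x}.indicator (1 : (ι → P) → ℝ) x := by
  by_cases hx : IsPivotal A i x
  · have ha0 : 0 ≤ avg μ i (A.indicator 1) x :=
      Finset.sum_nonneg fun p _ => mul_nonneg (h0 p) (indicator_one_nonneg _ _)
    have ha1 : avg μ i (A.indicator 1) x ≤ 1 := by
      rw [← h1]
      exact Finset.sum_le_sum fun p _ => mul_le_of_le_one_right (h0 p) (indicator_one_le_one _ _)
    have hb0 := indicator_one_nonneg A x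
    have hb1 := indicator_one_le_one A x
    rw [Set.indicator_of_mem (show x ∈ {x | IsPivotal A i x} from hx), Pi.one_apply, fluct, abs_le]
    constructor <;> linarith
  · have hc : ∀ p, A.indicator (1 : (ι → P) → ℝ) (update x i p) = A.indicator 1 x := by
      intro p
      simp only [IsPivotal, not_exists, not_and, not_not] at hx
      have e : x ∈ A ↔ update x i p ∈ A :=
        ⟨fun h => hx (x i) p (by rwa [update_eq_self]),
          fun h => by simpa using hx p (x i) h⟩
      by_cases h : x ∈ A
      · rw [Set.indicator_of_mem h, Set.indicator_of_mem (e.1 h)]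
        rfl
      · rw [Set.indicator_of_notMem h, Set.indicator_of_notMem (mt e.2 h)]
    rw [Set.indicator_of_notMem (show x ∉ {x | IsPivotal A i x} from hx), fluct, avg]
    simp only [hc, ← Finset.sum_mul, h1, one_mul, sub_self, abs_zero, le_refl]

variable [Fintype ι]

/-- Expectation with respect to the product of copies of `μ`. -/
def expect (μ : P → ℝ) (f : (ι → P) → ℝ) : ℝ := ∑ x, weight μ x * f x

theorem sum_sum_update_swap (i : ι) (H : (ι → P) → P → ℝ) :
    ∑ x, ∑ p, H x p = ∑ x, ∑ p, H (update x i p) (x i) := by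
  rw [← Fintype.sum_prod_type', ← Fintype.sum_prod_type']
  refine Finset.sum_nbij' (fun z => (update z.1 i z.2, z.1 i))
    (fun z => (update z.1 i z.2, z.1 i)) ?_ ?_ ?_ ?_ ?_ <;> simp

theorem sum_weight {μ : P → ℝ} (h1 : ∑ p, μ p = 1) : ∑ x : ι → P, weight μ x = 1 := by
  have := Finset.prod_univ_sum (fun _ : ι => (Finset.univ : Finset P)) (fun _ p => μ p)
  simp only [h1, Finset.prod_const_one, Fintype.piFinset_univ] at this
  exact this.symm

/-- Replacing the law of the coordinate `i` by an arbitrary weight `ν`. -/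
theorem sum_prod_erase_mul {μ : P → ℝ} (h1 : ∑ p, μ p = 1) (ν : P → ℝ) (i : ι)
    (f : (ι → P) → ℝ) :
    ∑ x : ι → P, (∏ j ∈ Finset.univ.erase i, μ (x j)) * ν (x i) * f x =
      expect μ (avg ν i f) := by
  simp only [expect, avg, Finset.mul_sum]
  rw [sum_sum_update_swap i]
  refine Finset.sum_congr rfl fun x _ => ?_
  simp only [weight_eq_mul μ i (update x i _), prod_erase_update, update_self, update_idem,
    update_eq_self]
  simp only [mul_assoc]
  rw [← Finset.sum_mul, h1, one_mul]

theorem expect_avg {μ : P → ℝ} (h1 : ∑ p, μ p = 1) (i : ι) (f : (ι → P) → ℝ) :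
    expect μ (avg μ i f) = expect μ f := by
  rw [← sum_prod_erase_mul h1]
  refine Finset.sum_congr rfl fun x _ => ?_
  rw [weight_eq_mul μ i x, mul_comm (μ (x i))]

theorem expect_mono {μ : P → ℝ} (h0 : ∀ p, 0 ≤ μ p) {f g : (ι → P) → ℝ} (h : ∀ x, f x ≤ g x) :
    expect μ f ≤ expect μ g :=
  Finset.sum_le_sum fun x _ => mul_le_mul_of_nonneg_left (h x) (weight_nonneg h0 x)

theorem expect_nonneg {μ : P → ℝ} (h0 : ∀ p, 0 ≤ μ p) {f : (ι → P) → ℝ} (h : ∀ x, 0 ≤ f x) :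
    0 ≤ expect μ f :=
  Finset.sum_nonneg fun x _ => mul_nonneg (weight_nonneg h0 x) (h x)

theorem expect_add (μ : P → ℝ) (f g : (ι → P) → ℝ) :
    expect μ (fun x => f x + g x) = expect μ f + expect μ g := by
  simp [expect, mul_add, Finset.sum_add_distrib]

theorem expect_sub (μ : P → ℝ) (f g : (ι → P) → ℝ) :
    expect μ (fun x => f x - g x) = expect μ f - expect μ g := by
  simp [expect, mul_sub, Finset.sum_sub_distrib]

theorem expect_const_mul (μ : P → ℝ) (c : ℝ) (f : (ι → P) → ℝ) :
    expect μ (fun x => c * f x) = c * expect μ f := by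
  simp only [expect, Finset.mul_sum]
  exact Finset.sum_congr rfl fun x _ => by ring

theorem expect_const {μ : P → ℝ} (h1 : ∑ p, μ p = 1) (c : ℝ) :
    expect μ (fun _ : ι → P => c) = c := by
  simp [expect, ← Finset.sum_mul, sum_weight h1]

theorem expect_mul_avg {μ : P → ℝ} (h1 : ∑ p, μ p = 1) (i : ι) {g : (ι → P) → ℝ}
    (hg : ∀ x p, g (update x i p) = g x) (f : (ι → P) → ℝ) :
    expect μ (fun x => g x * avg μ i f x) = expect μ (fun x => g x * f x) := by
  rw [← expect_avg h1 i (fun x => g x * f x)]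
  congr 1
  funext x
  simp only [avg, hg, Finset.mul_sum]
  exact Finset.sum_congr rfl fun p _ => by ring

theorem expect_sq_fluct {μ : P → ℝ} (h1 : ∑ p, μ p = 1) (i : ι) (f : (ι → P) → ℝ) :
    expect μ (fun x => fluct μ i f x ^ 2) =
      expect μ (fun x => f x ^ 2) - expect μ (fun x => avg μ i f x ^ 2) := by
  have h := expect_mul_avg h1 i (avg_update μ i f) f
  have h2 : expect μ (fun x => fluct μ i f x ^ 2) =
      expect μ (fun x => f x ^ 2) - expect μ (fun x => 2 * (avg μ i f x * f x))
        + expect μ (fun x => avg μ i f x * avg μ i f x) := by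
    rw [← expect_sub, ← expect_add]
    congr 1
    funext x
    simp only [fluct]
    ring
  rw [h2, expect_const_mul, ← h]
  simp only [sq]
  ring

theorem expect_sq_fluct_le {μ : P → ℝ} (h0 : ∀ p, 0 ≤ μ p) (h1 : ∑ p, μ p = 1) (i : ι)
    (f : (ι → P) → ℝ) :
    expect μ (fun x => fluct μ i f x ^ 2) ≤ expect μ (fun x => f x ^ 2) := by
  rw [expect_sq_fluct h1]
  linarith [expect_nonneg (μ := μ) h0 (f := fun x => avg μ i f x ^ 2) fun x => sq_nonneg _]

theorem expect_abs_succAvg_le {μ : P → ℝ} (h0 : ∀ p, 0 ≤ μ p) (h1 : ∑ p, μ p = 1) (e : ℕ → ι)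
    (f : (ι → P) → ℝ) (k : ℕ) :
    expect μ (fun x => |succAvg μ e f k x|) ≤ expect μ (fun x => |f x|) := by
  induction k with
  | zero => rfl
  | succ k ih =>
    refine le_trans ?_ ih
    rw [← expect_avg h1 (e k) (fun x => |succAvg μ e f k x|)]
    exact expect_mono h0 (abs_avg_le h0 _ _)

theorem expect_abs_mdiff_le {μ : P → ℝ} (h0 : ∀ p, 0 ≤ μ p) (h1 : ∑ p, μ p = 1) (e : ℕ → ι)
    (f : (ι → P) → ℝ) (k : ℕ) :
    expect μ (fun x => |mdiff μ e f k x|) ≤ expect μ (fun x => |fluct μ (e k) f x|) := by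
  rw [mdiff, ← succAvg_fluct]
  exact expect_abs_succAvg_le h0 h1 e _ k

theorem sum_expect_sq_mdiff {μ : P → ℝ} (h1 : ∑ p, μ p = 1) (e : ℕ → ι)
    (f : (ι → P) → ℝ) (N : ℕ) :
    ∑ k ∈ Finset.range N, expect μ (fun x => mdiff μ e f k x ^ 2) =
      expect μ (fun x => f x ^ 2) - expect μ (fun x => succAvg μ e f N x ^ 2) := by
  induction N with
  | zero => simp [succAvg]
  | succ N ih =>
    rw [Finset.sum_range_succ, ih, mdiff, expect_sq_fluct h1, succAvg]
    ring

theorem sum_expect_sq_mdiff_le {μ : P → ℝ} (h0 : ∀ p, 0 ≤ μ p) (h1 : ∑ p, μ p = 1) (e : ℕ → ι)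
    (f : (ι → P) → ℝ) (N : ℕ) :
    ∑ k ∈ Finset.range N, expect μ (fun x => mdiff μ e f k x ^ 2) ≤
      expect μ (fun x => f x ^ 2) := by
  rw [sum_expect_sq_mdiff h1]
  linarith [expect_nonneg (μ := μ) h0 (f := fun x => succAvg μ e f N x ^ 2) fun x => sq_nonneg _]

theorem succAvg_eq_expect {μ : P → ℝ} (h1 : ∑ p, μ p = 1) {e : ℕ → ι} {N : ℕ}
    (he : ∀ i, ∃ k < N, e k = i) (f : (ι → P) → ℝ) (x : ι → P) :
    succAvg μ e f N x = expect μ f := by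
  have hex : ∀ k, expect μ (succAvg μ e f k) = expect μ f := by
    intro k
    induction k with
    | zero => rfl
    | succ k ih => rw [succAvg, expect_avg h1, ih]
  rw [← hex N]
  have hc : ∀ y, succAvg μ e f N y = succAvg μ e f N x := fun y => by
    refine eq_of_forall_update (fun i z p => ?_) y x
    obtain ⟨k, hk, rfl⟩ := he i
    rw [← avg_succAvg_of_lt h1 e f hk, avg_update]
  rw [funext hc, expect_const h1]

theorem sum_expect_sq_mdiff_eq_variance {μ : P → ℝ} (h1 : ∑ p, μ p = 1) {e : ℕ → ι} {N : ℕ}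
    (he : ∀ i, ∃ k < N, e k = i) (f : (ι → P) → ℝ) :
    ∑ k ∈ Finset.range N, expect μ (fun x => mdiff μ e f k x ^ 2) =
      expect μ (fun x => f x ^ 2) - expect μ f ^ 2 := by
  rw [sum_expect_sq_mdiff h1]
  simp only [succAvg_eq_expect h1 he, expect_const h1]

theorem entropy_subadditive_of_pos {μ : P → ℝ} (h0 : ∀ p, 0 ≤ μ p) (h1 : ∑ p, μ p = 1)
    {e : ℕ → ι} {N : ℕ} (he : ∀ i, ∃ k < N, e k = i) {G : (ι → P) → ℝ} (hG : ∀ x, 0 < G x) :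
    expect μ (fun x => G x * Real.log (G x)) - expect μ G * Real.log (expect μ G) ≤
      ∑ k ∈ Finset.range N, (expect μ (fun x => G x * Real.log (G x)) -
        expect μ (fun x => avg μ (e k) G x * Real.log (avg μ (e k) G x))) := by
  have hS : ∀ k x, 0 < succAvg μ e G k x := by
    intro k
    induction k with
    | zero => exact hG
    | succ k ih => exact avg_pos h0 h1 _ ih
  have step : ∀ k, expect μ (fun x => G x * Real.log (succAvg μ e G k x)) -
      expect μ (fun x => G x * Real.log (succAvg μ e G (k + 1) x)) ≤
      expect μ (fun x => G x * Real.log (G x)) -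
        expect μ (fun x => avg μ (e k) G x * Real.log (avg μ (e k) G x)) := by
    intro k
    set S := succAvg μ e G k with hSdef
    have hS' : succAvg μ e G (k + 1) = avg μ (e k) S := rfl
    rw [hS']
    have hSp : ∀ x, 0 < S x := hS k
    have hAS := avg_pos h0 h1 (e k) hSp
    have hAG := avg_pos h0 h1 (e k) hG
    have e1 : expect μ (fun x => avg μ (e k) G x * Real.log (avg μ (e k) G x)) =
        expect μ (fun x => G x * Real.log (avg μ (e k) G x)) := by
      have := expect_mul_avg h1 (e k) (g := fun x => Real.log (avg μ (e k) G x))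
        (fun x p => by rw [avg_update]) G
      simpa only [mul_comm] using this
    have e2 : expect μ (fun x => avg μ (e k) G x / avg μ (e k) S x * S x) = expect μ G := by
      rw [← expect_mul_avg h1 (e k) (g := fun x => avg μ (e k) G x / avg μ (e k) S x)
        (fun x p => by simp only [avg_update]) S, ← expect_avg h1 (e k) G]
      congr 1
      funext x
      exact div_mul_cancel₀ _ (hAS x).ne'
    rw [e1, ← expect_sub, ← expect_sub]
    have hle : expect μ (fun x => G x * Real.log (S x) - G x * Real.log (avg μ (e k) S x)) ≤
        expect μ (fun x => (G x * Real.log (G x) - G x * Real.log (avg μ (e k) G x)) +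
          (avg μ (e k) G x / avg μ (e k) S x * S x - G x)) := by
      refine expect_mono h0 fun x => ?_
      have hl := Real.log_le_sub_one_of_pos
        (div_pos (mul_pos (hAG x) (hSp x)) (mul_pos (hAS x) (hG x)))
      rw [Real.log_div (mul_pos (hAG x) (hSp x)).ne' (mul_pos (hAS x) (hG x)).ne',
        Real.log_mul (hAG x).ne' (hSp x).ne', Real.log_mul (hAS x).ne' (hG x).ne'] at hl
      have hm := mul_le_mul_of_nonneg_left hl (hG x).le
      have : G x * (avg μ (e k) G x * S x / (avg μ (e k) S x * G x) - 1) =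
          avg μ (e k) G x / avg μ (e k) S x * S x - G x := by
        have := (hG x).ne'
        have := (hAS x).ne'
        field_simp
      rw [this] at hm
      linarith
    rw [expect_add, expect_sub _ (fun x => avg μ (e k) G x / avg μ (e k) S x * S x), e2] at hle
    linarith
  have tele := Finset.sum_le_sum fun k (_ : k ∈ Finset.range N) => step k
  rw [Finset.sum_range_sub'] at tele
  refine le_trans (le_of_eq ?_) tele
  simp only [succAvg_eq_expect h1 he]
  congr 1
  simp only [expect, Finset.sum_mul, mul_assoc]

theorem entropy_subadditive {μ : P → ℝ} (h0 : ∀ p, 0 ≤ μ p) (h1 : ∑ p, μ p = 1)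
    {e : ℕ → ι} {N : ℕ} (he : ∀ i, ∃ k < N, e k = i) {G : (ι → P) → ℝ} (hG : ∀ x, 0 ≤ G x) :
    expect μ (fun x => G x * Real.log (G x)) - expect μ G * Real.log (expect μ G) ≤
      ∑ k ∈ Finset.range N, (expect μ (fun x => G x * Real.log (G x)) -
        expect μ (fun x => avg μ (e k) G x * Real.log (avg μ (e k) G x))) := by
  have hφ : ∀ {u : ℝ → ℝ}, Continuous u → Continuous fun t => u t * Real.log (u t) :=
    fun hu => Real.continuous_mul_log.comp hu
  have hE : ∀ {F : ℝ → (ι → P) → ℝ}, (∀ x, Continuous fun t => F t x) →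
      Continuous fun t => expect μ (F t) := fun hF =>
    continuous_finsetSum _ fun x _ => continuous_const.mul (hF x)
  have hA : ∀ {F : ℝ → (ι → P) → ℝ}, (∀ x, Continuous fun t => F t x) →
      ∀ i x, Continuous fun t => avg μ i (F t) x := fun hF i x =>
    continuous_finsetSum _ fun p _ => continuous_const.mul (hF _)
  have hF : ∀ x, Continuous fun t : ℝ => G x + t := fun x => by fun_prop
  have hL : Continuous fun t : ℝ => expect μ (fun x => (G x + t) * Real.log (G x + t)) -
      expect μ (fun x => G x + t) * Real.log (expect μ (fun x => G x + t)) :=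
    (hE fun x => hφ (hF x)).sub (hφ (hE hF))
  have hR : Continuous fun t : ℝ => ∑ k ∈ Finset.range N,
      (expect μ (fun x => (G x + t) * Real.log (G x + t)) -
        expect μ (fun x => avg μ (e k) (fun y => G y + t) x *
          Real.log (avg μ (e k) (fun y => G y + t) x))) :=
    continuous_finsetSum _ fun k _ =>
      (hE fun x => hφ (hF x)).sub (hE fun x => hφ (hA hF (e k) x))
  have l1 := (hL.tendsto 0).mono_left (nhdsWithin_le_nhds (s := Set.Ioi 0))
  have l2 := (hR.tendsto 0).mono_left (nhdsWithin_le_nhds (s := Set.Ioi 0))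
  have := le_of_tendsto_of_tendsto l1 l2 (by
    filter_upwards [self_mem_nhdsWithin] with t ht
    exact entropy_subadditive_of_pos h0 h1 he fun x => add_pos_of_nonneg_of_pos (hG x) ht)
  simpa only [add_zero] using this

/-- A crude logarithmic Sobolev inequality on a finite probability space. -/
theorem entropy_sq_le {μ : P → ℝ} (h0 : ∀ p, 0 ≤ μ p) (h1 : ∑ p, μ p = 1) {l : ℝ} (hl : 0 < l)
    (hatom : ∀ p, μ p = 0 ∨ l ≤ μ p) (f : P → ℝ) :
    (∑ p, μ p * (f p ^ 2 * Real.log (f p ^ 2))) -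
        (∑ p, μ p * f p ^ 2) * Real.log (∑ p, μ p * f p ^ 2) ≤
      (2 / l + 2) * ∑ p, μ p * (f p - ∑ q, μ q * f q) ^ 2 := by
  set m := ∑ q, μ q * f q with hm
  set a := ∑ p, μ p * f p ^ 2 with ha
  have hnn : ∀ p ∈ Finset.univ, 0 ≤ μ p * f p ^ 2 := fun p _ => mul_nonneg (h0 p) (sq_nonneg _)
  have hV : 0 ≤ ∑ p, μ p * (f p - m) ^ 2 :=
    Finset.sum_nonneg fun p _ => mul_nonneg (h0 p) (sq_nonneg _)
  have ha0 : 0 ≤ a := Finset.sum_nonneg hnn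
  rcases ha0.eq_or_lt with haz | hap
  · have hz := (Finset.sum_eq_zero_iff_of_nonneg hnn).1 haz.symm
    have : ∑ p, μ p * (f p ^ 2 * Real.log (f p ^ 2)) = 0 := Finset.sum_eq_zero fun p hp => by
      rw [← mul_assoc, hz p hp, zero_mul]
    rw [this, ← haz]
    simp only [zero_mul, sub_zero]
    positivity
  have hma : m ^ 2 ≤ a := by
    have : ∑ p, μ p * (f p - m) ^ 2 = a - m ^ 2 := by
      have : ∀ p, μ p * (f p - m) ^ 2 = μ p * f p ^ 2 - 2 * m * (μ p * f p) + m ^ 2 * μ p :=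
        fun p => by ring
      simp only [this, Finset.sum_add_distrib, Finset.sum_sub_distrib, ← Finset.mul_sum, h1,
        ← hm, ← ha]
      ring
    linarith
  have hfa : ∀ p, l ≤ μ p → f p ^ 2 ≤ a / l := fun p hp => by
    rw [le_div_iff₀ hl]
    have := Finset.single_le_sum hnn (Finset.mem_univ p)
    nlinarith [sq_nonneg (f p)]
  have hterm : ∀ p, μ p * (f p ^ 2 * Real.log (f p ^ 2)) - μ p * f p ^ 2 * Real.log a ≤
      (2 / l + 2) * (μ p * (f p - m) ^ 2) +
        (2 * m ^ 2 * (μ p * f p ^ 2) - m ^ 4 * μ p) / a - μ p * f p ^ 2 := by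
    intro p
    rcases hatom p with hp | hp
    · simp [hp]
    have hlog : f p ^ 2 * Real.log (f p ^ 2) - f p ^ 2 * Real.log a ≤
        f p ^ 2 * (f p ^ 2 / a - 1) := by
      rcases (sq_nonneg (f p)).eq_or_lt with h | h
      · simp [← h]
      · rw [← mul_sub, ← Real.log_div h.ne' hap.ne']
        exact mul_le_mul_of_nonneg_left (Real.log_le_sub_one_of_pos (div_pos h hap)) h.le
    have hsq : (f p + m) ^ 2 / a ≤ 2 / l + 2 := by
      rw [div_le_iff₀ hap]
      have := hfa p hp
      have e : (2 / l + 2) * a = 2 * (a / l) + 2 * a := by ring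
      rw [e]
      nlinarith [sq_nonneg (f p - m)]
    have h3 := mul_le_mul_of_nonneg_left hsq (sq_nonneg (f p - m))
    have h4 : f p ^ 2 * (f p ^ 2 / a - 1) =
        (f p - m) ^ 2 * ((f p + m) ^ 2 / a) + (2 * m ^ 2 * f p ^ 2 - m ^ 4) / a - f p ^ 2 := by
      field_simp
      ring
    have h5 : f p ^ 2 * Real.log (f p ^ 2) - f p ^ 2 * Real.log a ≤
        (f p - m) ^ 2 * (2 / l + 2) + (2 * m ^ 2 * f p ^ 2 - m ^ 4) / a - f p ^ 2 := by linarith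
    have h6 := mul_le_mul_of_nonneg_left h5 (h0 p)
    calc _ = μ p * (f p ^ 2 * Real.log (f p ^ 2) - f p ^ 2 * Real.log a) := by ring
      _ ≤ _ := h6
      _ = _ := by ring
  have hsum := Finset.sum_le_sum fun p (_ : p ∈ Finset.univ) => hterm p
  simp only [Finset.sum_add_distrib, Finset.sum_sub_distrib, ← Finset.mul_sum, ← Finset.sum_mul,
    ← Finset.sum_div, h1, ← ha] at hsum
  refine hsum.trans ?_
  have : (2 * m ^ 2 * a - m ^ 4 * 1) / a ≤ a := by
    rw [div_le_iff₀ hap]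
    nlinarith [sq_nonneg (a - m ^ 2)]
  linarith

theorem entropy_sq_le_sum_fluct {μ : P → ℝ} (h0 : ∀ p, 0 ≤ μ p) (h1 : ∑ p, μ p = 1) {l : ℝ}
    (hl : 0 < l) (hatom : ∀ p, μ p = 0 ∨ l ≤ μ p) {e : ℕ → ι} {N : ℕ}
    (he : ∀ i, ∃ k < N, e k = i) (g : (ι → P) → ℝ) :
    expect μ (fun x => g x ^ 2 * Real.log (g x ^ 2)) -
        expect μ (fun x => g x ^ 2) * Real.log (expect μ (fun x => g x ^ 2)) ≤
      (2 / l + 2) * ∑ k ∈ Finset.range N, expect μ (fun x => fluct μ (e k) g x ^ 2) := by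
  refine (entropy_subadditive h0 h1 he (G := fun x => g x ^ 2) fun x => sq_nonneg _).trans ?_
  rw [Finset.mul_sum]
  refine Finset.sum_le_sum fun k _ => ?_
  rw [← expect_avg h1 (e k) (fun x => g x ^ 2 * Real.log (g x ^ 2)), ← expect_sub,
    ← expect_avg h1 (e k) (fun x => fluct μ (e k) g x ^ 2), ← expect_const_mul]
  refine expect_mono h0 fun x => ?_
  have := entropy_sq_le h0 h1 hl hatom fun p => g (update x (e k) p)
  simpa only [avg, fluct, update_idem] using this

theorem mul_log_le_entropy_sq {μ : P → ℝ} (h0 : ∀ p, 0 ≤ μ p) {I : ℝ} (hI : 0 < I)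
    (g : (ι → P) → ℝ) (hg : expect μ (fun x => |g x|) ≤ I) :
    expect μ (fun x => g x ^ 2) * Real.log (expect μ (fun x => g x ^ 2) / I ^ 2) ≤
      expect μ (fun x => g x ^ 2 * Real.log (g x ^ 2)) -
        expect μ (fun x => g x ^ 2) * Real.log (expect μ (fun x => g x ^ 2)) := by
  set a := expect μ (fun x => g x ^ 2) with ha
  have ha0 : 0 ≤ a := expect_nonneg h0 fun x => sq_nonneg _
  rcases ha0.eq_or_lt with haz | hap
  · have hz := (Finset.sum_eq_zero_iff_of_nonneg fun x _ =>
      mul_nonneg (weight_nonneg h0 x) (sq_nonneg (g x))).1 haz.symm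
    have : expect μ (fun x => g x ^ 2 * Real.log (g x ^ 2)) = 0 :=
      Finset.sum_eq_zero fun x hx => by rw [← mul_assoc, hz x hx, zero_mul]
    rw [this, ← haz]
    simp
  have hpt : expect μ (fun x => 2 * Real.log (a / I) * g x ^ 2 - g x ^ 2 * Real.log (g x ^ 2)) ≤
      expect μ (fun x => 2 * (a / I) * |g x| - 2 * g x ^ 2) := by
    refine expect_mono h0 fun x => ?_
    rcases eq_or_ne (g x) 0 with h | h
    · simp [h]
    have hgp : 0 < |g x| := abs_pos.2 h
    have h2 := Real.log_le_sub_one_of_pos (div_pos (div_pos hap hI) hgp)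
    rw [Real.log_div (div_pos hap hI).ne' hgp.ne'] at h2
    have h3 := mul_le_mul_of_nonneg_left h2 (mul_pos hgp hgp).le
    have h4 : |g x| * |g x| * (a / I / |g x| - 1) = a / I * |g x| - |g x| * |g x| := by
      field_simp
    rw [h4, abs_mul_abs_self, ← sq] at h3
    rw [← sq_abs (g x), Real.log_pow, sq_abs]
    push_cast
    linarith
  rw [expect_sub, expect_sub, expect_const_mul, expect_const_mul, expect_const_mul, ← ha] at hpt
  have h5 : 2 * (a / I) * expect μ (fun x => |g x|) ≤ 2 * a := by
    calc _ ≤ 2 * (a / I) * I := by gcongr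
      _ = _ := by field_simp
  rw [Real.log_div hap.ne' (by positivity), Real.log_pow]
  rw [Real.log_div hap.ne' hI.ne'] at hpt
  push_cast
  linarith

/-- A form of Talagrand's inequality for functions all of whose `L¹` influences are at most `I`. -/
theorem variance_mul_log_le {μ : P → ℝ} (h0 : ∀ p, 0 ≤ μ p) (h1 : ∑ p, μ p = 1) {l : ℝ}
    (hl : 0 < l) (hatom : ∀ p, μ p = 0 ∨ l ≤ μ p) {e : ℕ → ι} {N : ℕ} (hN : 0 < N)
    (he : ∀ i, ∃ k < N, e k = i) (f : (ι → P) → ℝ) {I : ℝ} (hI : 0 < I)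
    (hf1 : ∀ i, expect μ (fun x => |fluct μ i f x|) ≤ I)
    (hf2 : ∀ i, expect μ (fun x => fluct μ i f x ^ 2) ≤ I)
    {V : ℝ} (hV : expect μ (fun x => f x ^ 2) - expect μ f ^ 2 = V) (hVp : 0 < V) :
    V * Real.log (V / (N * I ^ 2)) ≤ (2 / l + 2) * (N * I) := by
  set a : ℕ → ℝ := fun k => expect μ (fun x => mdiff μ e f k x ^ 2) with ha
  have hNR : (0 : ℝ) < N := by exact_mod_cast hN
  have hsum : ∑ k ∈ Finset.range N, a k = V := by
    rw [← hV]
    exact sum_expect_sq_mdiff_eq_variance h1 he f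
  have hk : ∀ k ∈ Finset.range N, a k * Real.log (V / (N * I ^ 2)) + (a k - V / N) ≤
      (2 / l + 2) * ∑ j ∈ Finset.range N,
        expect μ (fun x => mdiff μ e (fluct μ (e j) f) k x ^ 2) := by
    intro k _
    have u1 := mul_log_le_entropy_sq h0 hI (mdiff μ e f k)
      ((expect_abs_mdiff_le h0 h1 e f k).trans (hf1 _))
    have u2 := entropy_sq_le_sum_fluct h0 h1 hl hatom he (mdiff μ e f k)
    simp only [← mdiff_fluct] at u2
    refine le_trans ?_ (u1.trans u2)
    change _ ≤ a k * Real.log (a k / I ^ 2)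
    have hak : 0 ≤ a k := expect_nonneg h0 fun x => sq_nonneg _
    have hVN : 0 < V / N := by positivity
    rcases hak.eq_or_lt with hz | hp
    · rw [← hz]
      simpa using hVN.le
    have u3 := mul_le_mul_of_nonneg_left (Real.log_le_sub_one_of_pos (div_pos hVN hp)) hp.le
    have u4 : a k * (V / N / a k - 1) = V / N - a k := by field_simp
    rw [u4, Real.log_div hVN.ne' hp.ne'] at u3
    rw [← div_div, Real.log_div hVN.ne' (by positivity), Real.log_div hp.ne' (by positivity)]
    linarith
  have hs := Finset.sum_le_sum hk
  rw [Finset.sum_add_distrib, Finset.sum_sub_distrib, ← Finset.sum_mul, hsum, ← Finset.mul_sum,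
    Finset.sum_comm] at hs
  have hs2 : ∑ j ∈ Finset.range N, ∑ k ∈ Finset.range N,
      expect μ (fun x => mdiff μ e (fluct μ (e j) f) k x ^ 2) ≤ N * I := by
    calc _ ≤ ∑ j ∈ Finset.range N, I := Finset.sum_le_sum fun j _ =>
          (sum_expect_sq_mdiff_le h0 h1 e _ N).trans (hf2 _)
      _ = _ := by simp
  have hs3 : ∑ k ∈ Finset.range N, V / N = V := by
    simp
    field_simp
  rw [hs3] at hs
  have hC : 0 ≤ 2 / l + 2 := by positivity
  nlinarith [mul_le_mul_of_nonneg_left hs2 hC]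

/-- The probability that the coordinate `i` is pivotal. -/
def influence (μ : P → ℝ) (A : Set (ι → P)) (i : ι) : ℝ :=
  expect μ ({x | IsPivotal A i x}.indicator 1)

/-- The product measure of `A`. -/
def prob (μ : P → ℝ) (A : Set (ι → P)) : ℝ := expect μ (A.indicator 1)

theorem prob_eq_sum (μ : P → ℝ) (A : Set (ι → P)) :
    prob μ A = ∑ x, A.indicator (fun y => ∏ i, μ (y i)) x := by
  refine Finset.sum_congr rfl fun x _ => ?_
  by_cases hx : x ∈ A <;> simp [hx, weight]

theorem influence_nonneg {μ : P → ℝ} (h0 : ∀ p, 0 ≤ μ p) (A : Set (ι → P)) (i : ι) :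
    0 ≤ influence μ A i :=
  expect_nonneg h0 (indicator_one_nonneg _)

/-- The Kahn–Kalai–Linial inequality for sets with equal influences. -/
theorem variance_mul_log_le_influence {μ : P → ℝ} (h0 : ∀ p, 0 ≤ μ p) (h1 : ∑ p, μ p = 1)
    {l : ℝ} (hl : 0 < l) (hatom : ∀ p, μ p = 0 ∨ l ≤ μ p) {e : ℕ → ι} {N : ℕ} (hN : 0 < N)
    (he : ∀ i, ∃ k < N, e k = i) (A : Set (ι → P)) {I : ℝ} (hI : ∀ i, influence μ A i = I)
    {c : ℝ} (hc : 0 < c) (hc4 : c ≤ 1 / 4) (hcl : (2 / l + 2) * c ≤ 1 / 2) :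
    c * (prob μ A * (1 - prob μ A)) * Real.log N ≤ N * I := by
  set V := prob μ A * (1 - prob μ A) with hV
  set L := Real.log N with hL
  have hNR : (0 : ℝ) < N := by exact_mod_cast hN
  have hL0 : 0 ≤ L := Real.log_natCast_nonneg N
  have hI0 : 0 ≤ I := by
    rw [← hI (e 0)]
    exact influence_nonneg h0 A _
  have hNI : 0 ≤ N * I := mul_nonneg hNR.le hI0
  rcases le_or_gt V 0 with hV0 | hVp
  · exact (mul_nonpos_of_nonpos_of_nonneg (mul_nonpos_of_nonneg_of_nonpos hc.le hV0) hL0).trans hNI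
  rcases hL0.eq_or_lt with hLz | hLp
  · rw [← hLz, mul_zero]
    exact hNI
  by_contra! hlt
  set J := c * V * L / N with hJ
  have hNJ : N * J = c * V * L := by
    rw [hJ]
    field_simp
  have hJp : 0 < J := by positivity
  have hIJ : I ≤ J := by
    rw [hJ, le_div_iff₀ hNR]
    linarith
  have hf1 : ∀ i, expect μ (fun x => |fluct μ i (A.indicator 1) x|) ≤ J := fun i =>
    (expect_mono h0 (abs_fluct_indicator_le h0 h1 A i)).trans ((hI i).trans_le hIJ)
  have hf2 : ∀ i, expect μ (fun x => fluct μ i (A.indicator 1) x ^ 2) ≤ J := fun i => by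
    refine le_trans (expect_mono h0 fun x => ?_) (hf1 i)
    rw [← sq_abs, sq]
    exact mul_le_of_le_one_left (abs_nonneg _)
      ((abs_fluct_indicator_le h0 h1 A i x).trans (indicator_one_le_one _ _))
  have hvar : expect μ (fun x => A.indicator (1 : (ι → P) → ℝ) x ^ 2) -
      expect μ (A.indicator 1) ^ 2 = V := by
    have : (fun x => A.indicator (1 : (ι → P) → ℝ) x ^ 2) = A.indicator 1 := by
      funext x
      by_cases hx : x ∈ A <;> simp [hx]
    rw [this, hV, prob]
    ring
  have key := variance_mul_log_le h0 h1 hl hatom hN he _ hJp hf1 hf2 hvar hVp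
  rw [hNJ] at key
  have hV4 : V ≤ 1 := by nlinarith [sq_nonneg (prob μ A - 1 / 2)]
  have hlog : L / 2 < Real.log (V / (N * J ^ 2)) := by
    have e1 : V / (N * J ^ 2) = N / (c ^ 2 * V * L ^ 2) := by
      rw [hJ]
      field_simp
    rw [e1, Real.log_div hNR.ne' (by positivity), ← hL]
    have h2 : Real.log (c ^ 2 * V * L ^ 2) ≤ Real.log ((L / 4) ^ 2) := by
      refine Real.log_le_log (by positivity) ?_
      have : c ^ 2 * V ≤ (1 / 4) ^ 2 * 1 := by gcongr
      nlinarith [sq_nonneg L]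
    have h3 := Real.log_le_sub_one_of_pos (show 0 < L / 4 by positivity)
    rw [Real.log_pow] at h2
    push_cast at h2
    linarith
  have h1' := mul_lt_mul_of_pos_left hlog hVp
  have h2' := mul_le_mul_of_nonneg_right hcl (mul_pos hVp hLp).le
  nlinarith

theorem influence_eq_of_invariant {μ : P → ℝ} {A : Set (ι → P)} {σ : Equiv.Perm ι}
    (hσ : ∀ ω, (fun i => ω (σ⁻¹ i)) ∈ A ↔ ω ∈ A) (i : ι) :
    influence μ A i = influence μ A (σ i) := by
  symm
  rw [influence, influence, expect, expect,
    ← Equiv.sum_comp (σ.arrowCongr (Equiv.refl P)) (fun x => weight μ x * _)]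
  refine Finset.sum_congr rfl fun x _ => ?_
  have hx : σ.arrowCongr (Equiv.refl P) x = fun j => x (σ⁻¹ j) := rfl
  have hw : weight μ (fun j => x (σ⁻¹ j)) = weight μ x :=
    Equiv.prod_comp σ⁻¹ fun j => μ (x j)
  have hu : ∀ p, update (fun j => x (σ⁻¹ j)) (σ i) p = fun j => update x i p (σ⁻¹ j) := by
    intro p
    funext j
    rcases eq_or_ne j (σ i) with rfl | hj
    · simp
    · rw [update_of_ne hj, update_of_ne]
      rintro rfl
      simp at hj
  have hp : IsPivotal A (σ i) (fun j => x (σ⁻¹ j)) ↔ IsPivotal A i x := by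
    simp only [IsPivotal, hu, hσ]
  rw [hx, hw]
  congr 1
  by_cases h : IsPivotal A i x
  · rw [Set.indicator_of_mem (show x ∈ {x | IsPivotal A i x} from h),
      Set.indicator_of_mem (show _ ∈ {x | IsPivotal A (σ i) x} from hp.2 h)]
    rfl
  · rw [Set.indicator_of_notMem (show x ∉ {x | IsPivotal A i x} from h),
      Set.indicator_of_notMem (show _ ∉ {x | IsPivotal A (σ i) x} from mt hp.1 h)]

/-- A Russo-type formula along a segment of measures. -/
theorem hasDerivAt_expect {μ ν : P → ℝ} {t : ℝ} (h1 : ∑ p, (μ p + t * ν p) = 1)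
    (f : (ι → P) → ℝ) :
    HasDerivAt (fun s => expect (fun p => μ p + s * ν p) f)
      (∑ i, expect (fun p => μ p + t * ν p) (avg ν i f)) t := by
  have hd : ∀ x : ι → P, HasDerivAt (fun s => weight (fun p => μ p + s * ν p) x * f x)
      ((∑ i, (∏ j ∈ Finset.univ.erase i, (μ (x j) + t * ν (x j))) • ν (x i)) * f x) t := by
    intro x
    refine HasDerivAt.mul_const ?_ _
    refine HasDerivAt.fun_finsetProd fun i _ => ?_
    simpa using ((hasDerivAt_id t).mul_const (ν (x i))).const_add (μ (x i))
  have := HasDerivAt.fun_sum fun x (_ : x ∈ Finset.univ) => hd x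
  refine this.congr_deriv ?_
  simp only [← sum_prod_erase_mul h1, Finset.sum_mul, smul_eq_mul]
  rw [Finset.sum_comm]

theorem mul_influence_le_expect_avg [PartialOrder P] {μ ν : P → ℝ} (h0 : ∀ p, 0 ≤ μ p)
    (hν : ∑ p, ν p = 0) {δ : ℝ}
    (hδ : ∀ U : Set P, IsUpperSet U → U ≠ ∅ → U ≠ Set.univ → δ ≤ ∑ p, U.indicator ν p)
    {A : Set (ι → P)} (hA : IsUpperSet A) (i : ι) :
    δ * influence μ A i ≤ expect μ (avg ν i (A.indicator 1)) := by
  rw [influence, ← expect_const_mul]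
  refine expect_mono h0 fun x => ?_
  have hU : IsUpperSet {p | update x i p ∈ A} := fun p q hpq hp =>
    hA (update_le_update_iff.2 ⟨hpq, fun _ _ => le_rfl⟩) hp
  have hav : avg ν i (A.indicator 1) x = ∑ p, {p | update x i p ∈ A}.indicator ν p := by
    refine Finset.sum_congr rfl fun p _ => ?_
    by_cases hp : update x i p ∈ A <;> simp [hp]
  rw [hav]
  by_cases hx : IsPivotal A i x
  · rw [Set.indicator_of_mem (show x ∈ {x | IsPivotal A i x} from hx), Pi.one_apply, mul_one]
    obtain ⟨p, q, hp, hq⟩ := hx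
    exact hδ _ hU (Set.Nonempty.ne_empty ⟨p, hp⟩) fun h =>
      hq (h ▸ Set.mem_univ q : q ∈ {p | update x i p ∈ A})
  · rw [Set.indicator_of_notMem (show x ∉ {x | IsPivotal A i x} from hx), mul_zero]
    simp only [IsPivotal, not_exists, not_and, not_not] at hx
    rcases Set.eq_empty_or_nonempty {p | update x i p ∈ A} with h | ⟨p, hp⟩
    · simp [h]
    · have : {p | update x i p ∈ A} = Set.univ := Set.eq_univ_of_forall fun q => hx p q hp
      simp [this, hν]

end

theorem exists_pos_le_of_finite {α : Type*} [Finite α] {g : α → ℝ} {q : α → Prop}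
    (h : ∀ a, q a → 0 < g a) : ∃ δ > 0, ∀ a, q a → δ ≤ g a := by
  classical
  rcases isEmpty_or_nonempty α with _ | _
  · exact ⟨1, one_pos, fun a => isEmptyElim a⟩
  obtain ⟨a, ha⟩ := Finite.exists_min fun a => if q a then g a else 1
  refine ⟨if q a then g a else 1, ?_, fun b hb => ?_⟩
  · split_ifs with hq
    exacts [h a hq, one_pos]
  · simpa [hb] using ha b

theorem one_sub_lt_of_logistic_growth {h h' : ℝ → ℝ} {K ε : ℝ}
    (hd : ∀ t, HasDerivAt h (h' t) t) (hnn : ∀ t ∈ Set.Icc (0 : ℝ) 1, 0 ≤ h' t)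
    (hK : ∀ t ∈ Set.Icc (1 / 4 : ℝ) (3 / 4), K * (h t * (1 - h t)) ≤ h' t)
    (hε : 0 < ε) (hε2 : ε < 1 / 2) (h0 : ε < h 0) (hlog : Real.log (1 / ε) ≤ K / 4) :
    1 - ε < h 1 := by
  by_contra! hle
  have hmono : MonotoneOn h (Set.Icc 0 1) := by
    refine monotoneOn_of_deriv_nonneg (convex_Icc 0 1)
      (fun t _ => (hd t).continuousAt.continuousWithinAt)
      (fun t _ => (hd t).differentiableAt.differentiableWithinAt) fun t ht => ?_
    rw [(hd t).deriv]
    exact hnn t (interior_subset ht)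
  have hlo : ∀ t ∈ Set.Icc (0 : ℝ) 1, ε < h t := fun t ht =>
    h0.trans_le (hmono ⟨le_rfl, zero_le_one⟩ ht ht.1)
  have hhi : ∀ t ∈ Set.Icc (0 : ℝ) 1, h t ≤ 1 - ε := fun t ht =>
    (hmono ht ⟨zero_le_one, le_rfl⟩ ht.2).trans hle
  have hsub : ∀ t ∈ Set.Icc (1 / 4 : ℝ) (3 / 4), t ∈ Set.Icc (0 : ℝ) 1 := fun t ht =>
    ⟨by linarith [ht.1], by linarith [ht.2]⟩
  have hψ : ∀ t ∈ Set.Icc (1 / 4 : ℝ) (3 / 4),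
      HasDerivAt (fun s => Real.log (h s) - Real.log (1 - h s) - K * s)
        (h' t / h t - (-h' t) / (1 - h t) - K) t := by
    intro t ht
    have p1 : h t ≠ 0 := by linarith [hlo t (hsub t ht)]
    have p2 : 1 - h t ≠ 0 := by linarith [hhi t (hsub t ht)]
    have d3 : HasDerivAt (fun s => K * s) K t := by
      simpa using (hasDerivAt_id t).const_mul K
    exact (((hd t).log p1).sub (((hd t).const_sub 1).log p2)).sub d3
  have hψm : MonotoneOn (fun s => Real.log (h s) - Real.log (1 - h s) - K * s)
      (Set.Icc (1 / 4) (3 / 4)) := by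
    refine monotoneOn_of_deriv_nonneg (convex_Icc _ _)
      (fun t ht => (hψ t ht).continuousAt.continuousWithinAt)
      (fun t ht => (hψ t (interior_subset ht)).differentiableAt.differentiableWithinAt)
      fun t ht => ?_
    have ht := interior_subset ht
    rw [(hψ t ht).deriv]
    have p1 : 0 < h t := by linarith [hlo t (hsub t ht)]
    have p2 : 0 < 1 - h t := by linarith [hhi t (hsub t ht)]
    have : h' t / h t - (-h' t) / (1 - h t) - K =
        (h' t - K * (h t * (1 - h t))) / (h t * (1 - h t)) := by
      field_simp
      ring
    rw [this]
    exact div_nonneg (by linarith [hK t ht]) (mul_pos p1 p2).le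
  have q1 : (1 / 4 : ℝ) ∈ Set.Icc (1 / 4 : ℝ) (3 / 4) := by constructor <;> norm_num
  have q3 : (3 / 4 : ℝ) ∈ Set.Icc (1 / 4 : ℝ) (3 / 4) := by constructor <;> norm_num
  have hm := hψm q1 q3 (by norm_num)
  simp only at hm
  have a1 := hlo _ (hsub _ q1)
  have a2 := hhi _ (hsub _ q1)
  have b1 := hlo _ (hsub _ q3)
  have b2 := hhi _ (hsub _ q3)
  have l1 := Real.log_lt_log hε a1
  have l2 : Real.log (1 - h (1 / 4)) ≤ 0 := Real.log_nonpos (by linarith) (by linarith)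
  have l3 : Real.log (h (3 / 4)) ≤ 0 := Real.log_nonpos (by linarith) (by linarith)
  have l4 := Real.log_le_log hε (show ε ≤ 1 - h (3 / 4) by linarith)
  rw [one_div, Real.log_inv] at hlog
  linarith

end ProductThreshold

open ProductThreshold


/-- **Sharp-threshold theorem for symmetric upsets in powers of a poset**
(Theorem 6.2): if `μ₁` strictly dominates `μ₀` on a finite poset `P`, then
there is `c₁ = c₁(μ₀, μ₁) > 0` such that for every `0 < ε < 1/2`, `n ≥ 1` and
symmetric upset `A ⊆ P^n`, if `μ₀^n(A) > ε` and `c₁ log n ≥ log(1/ε)`, then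
`μ₁^n(A) > 1 − ε`. -/
theorem sharp_threshold_posets (P : Type) [Fintype P] [PartialOrder P]
    (μ0 μ1 : P → ℝ)
    (hμ00 : ∀ x, 0 ≤ μ0 x) (hμ01 : ∑ x : P, μ0 x = 1)
    (hμ10 : ∀ x, 0 ≤ μ1 x) (hμ11 : ∑ x : P, μ1 x = 1)
    (hdom : ∀ U : Set P, IsUpperSet U → U ≠ ∅ → U ≠ Set.univ →
      (∑ x : P, U.indicator μ0 x) < (∑ x : P, U.indicator μ1 x)) :
    ∃ c1 : ℝ, 0 < c1 ∧
      ∀ (ε : ℝ), 0 < ε → ε < 1 / 2 →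
      ∀ (n : ℕ), 1 ≤ n →
      ∀ A : Set (Fin n → P), IsUpperSet A →
        (∃ G : Subgroup (Equiv.Perm (Fin n)),
          (∀ i j : Fin n, ∃ σ ∈ G, σ i = j) ∧
          (∀ σ ∈ G, ∀ ω ∈ A, (fun i => ω (σ⁻¹ i)) ∈ A)) →
        (∑ x : Fin n → P, A.indicator (fun y => ∏ i, μ0 (y i)) x) > ε →
        c1 * Real.log n ≥ Real.log (1 / ε) →
        (∑ x : Fin n → P, A.indicator (fun y => ∏ i, μ1 (y i)) x) > 1 - ε := by
  classical
  have hne : Nonempty P := by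
    by_contra hE
    rw [not_nonempty_iff] at hE
    simp at hμ01
  obtain ⟨δ, hδ, hδU⟩ := exists_pos_le_of_finite
    (g := fun U : Set P => ∑ x, U.indicator (fun p => μ1 p - μ0 p) x)
    (q := fun U => IsUpperSet U ∧ U ≠ ∅ ∧ U ≠ Set.univ) fun U hU => by
      have := hdom U hU.1 hU.2.1 hU.2.2
      have e : ∀ x, U.indicator (fun p => μ1 p - μ0 p) x = U.indicator μ1 x - U.indicator μ0 x :=
        fun x => by by_cases hx : x ∈ U <;> simp [hx]
      simp only [e, Finset.sum_sub_distrib]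
      linarith
  obtain ⟨l, hl, hlP⟩ := exists_pos_le_of_finite
    (g := fun p => μ0 p + μ1 p) (q := fun p => 0 < μ0 p + μ1 p) fun _ h => h
  set C := 2 / (l / 4) + 2 with hC
  have hCp : 0 < C := by positivity
  set c := min (1 / 4) (1 / (2 * C)) with hc
  have hcp : 0 < c := by positivity
  have hCc : C * c ≤ 1 / 2 := by
    calc C * c ≤ C * (1 / (2 * C)) := by gcongr; exact min_le_right _ _
      _ = 1 / 2 := by field_simp
  refine ⟨δ * c / 4, by positivity, ?_⟩
  rintro ε hε hε2 n hn A hA ⟨G, htrans, hinv⟩ hA0 hlog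
  have : NeZero n := ⟨by omega⟩
  rw [← prob_eq_sum] at hA0 ⊢
  set m : ℝ → P → ℝ := fun t p => μ0 p + t * (μ1 p - μ0 p) with hm
  have hν : ∑ p, (μ1 p - μ0 p) = 0 := by rw [Finset.sum_sub_distrib, hμ01, hμ11, sub_self]
  have m0 : ∀ t ∈ Set.Icc (0 : ℝ) 1, ∀ p, 0 ≤ m t p := fun t ht p => by
    have : m t p = (1 - t) * μ0 p + t * μ1 p := by simp only [hm]; ring
    rw [this]
    exact add_nonneg (mul_nonneg (by linarith [ht.2]) (hμ00 p)) (mul_nonneg ht.1 (hμ10 p))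
  have m1 : ∀ t, ∑ p, m t p = 1 := fun t => by
    simp only [hm, Finset.sum_add_distrib, ← Finset.mul_sum, hν, hμ01, mul_zero, add_zero]
  have hinf : ∀ t i j, influence (m t) A i = influence (m t) A j := by
    intro t i j
    obtain ⟨σ, hσ, rfl⟩ := htrans i j
    refine influence_eq_of_invariant (fun ω => ⟨fun h => ?_, hinv σ hσ ω⟩) i
    simpa using hinv σ⁻¹ (G.inv_mem hσ) _ h
  have hlow : ∀ t ∈ Set.Icc (0 : ℝ) 1, δ * (n * influence (m t) A 0) ≤
      ∑ i, expect (m t) (avg (fun p => μ1 p - μ0 p) i (A.indicator 1)) := by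
    intro t ht
    calc _ = ∑ i : Fin n, δ * influence (m t) A i := by
          simp only [hinf t _ 0, Finset.sum_const, Finset.card_univ, Fintype.card_fin,
            nsmul_eq_mul]
          ring
      _ ≤ _ := Finset.sum_le_sum fun i _ => mul_influence_le_expect_avg (m0 t ht) hν
          (fun U h1 h2 h3 => hδU U ⟨h1, h2, h3⟩) hA i
  have hfin : 1 - ε < prob (m 1) A := by
    refine one_sub_lt_of_logistic_growth (K := δ * c * Real.log n)
      (h := fun t => prob (m t) A) (fun t => hasDerivAt_expect (m1 t) _)
      (fun t ht => le_trans ?_ (hlow t ht)) (fun t ht => ?_) hε hε2 ?_ (by linarith)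
    · exact mul_nonneg hδ.le (mul_nonneg (Nat.cast_nonneg n) (influence_nonneg (m0 t ht) A 0))
    · have ht1 : t ∈ Set.Icc (0 : ℝ) 1 := ⟨by linarith [ht.1], by linarith [ht.2]⟩
      refine le_trans ?_ (hlow t ht1)
      have hatom : ∀ p, m t p = 0 ∨ l / 4 ≤ m t p := fun p => by
        have e : m t p = (1 - t) * μ0 p + t * μ1 p := by simp only [hm]; ring
        rcases (add_nonneg (hμ00 p) (hμ10 p)).eq_or_lt with hz | hp
        · left
          have h00 : μ0 p = 0 := by linarith [hμ00 p, hμ10 p]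
          have h10 : μ1 p = 0 := by linarith [hμ00 p, hμ10 p]
          simp [e, h00, h10]
        · right
          have := hlP p hp
          rw [e]
          nlinarith [mul_nonneg (sub_nonneg.2 ht.1) (hμ10 p),
            mul_nonneg (sub_nonneg.2 ht.2) (hμ00 p)]
      have := variance_mul_log_le_influence (m0 t ht1) (m1 t) (by positivity) hatom
        (e := fun k => Fin.ofNat n k) hn
        (fun i => ⟨i, i.2, by simp⟩) A (fun i => hinf t i 0) hcp (min_le_left _ _) hCc
      calc _ = δ * (c * (prob (m t) A * (1 - prob (m t) A)) * Real.log n) := by ring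
        _ ≤ _ := mul_le_mul_of_nonneg_left this hδ.le
    · simpa [hm] using hA0
  simpa [hm] using hfin
end

section
/- Abstract generalized Harris lemma for infinite products: Let P be a finite poset with a greatest element x_0, and let μ be a probability measure on P with μ(x_0) > 0. Then there exists a function F : (0,1] × (0,1] → (0,1], strictly increasing in each argument, such that for the product probability measure μ^ℕ on P^ℕ (with the product σ-algebra) and any two measurable upsets A and B in P^ℕ with μ^ℕ(A) > 0 and μ^ℕ(B) > 0, one has μ^ℕ(A ∩ B) ≥ F(μ^ℕ(A), μ^ℕ(B)). -/
open MeasureTheory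

section WeightedSums

theorem one_add_mul_add_sq_le_pow {y : ℝ} (hy : 0 ≤ y) (k : ℕ) :
    1 + k * y + k * (k - 1) / 2 * y ^ 2 ≤ (1 + y) ^ k := by
  induction k with
  | zero => simp
  | succ k ih =>
    have hk : (0 : ℝ) ≤ k * (k - 1) := by
      rcases k.eq_zero_or_pos with rfl | h
      · simp
      · have : (1 : ℝ) ≤ k := by exact_mod_cast h
        nlinarith
    have hm := mul_le_mul_of_nonneg_right ih (by linarith : 0 ≤ 1 + y)
    have h3 : 0 ≤ k * (k - 1) * y ^ 3 := by positivity
    rw [pow_succ (1 + y) k]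
    push_cast
    nlinarith

variable {ι : Type*} [Fintype ι] {w f g : ι → ℝ} {i₀ : ι} {k : ℕ}

theorem one_le_sum_mul_mul_pow (hw : ∀ i, 0 ≤ w i) (hw1 : ∑ i, w i = 1)
    (hk : 1 ≤ 2 * w i₀ * (k - 1)) (hf : ∀ i, 0 ≤ f i) (hg : ∀ i, 0 ≤ g i)
    (hfm : ∀ i, f i ≤ f i₀) (hgm : ∀ i, g i ≤ g i₀)
    (hf1 : ∑ i, w i * f i = 1) (hg1 : ∑ i, w i * g i = 1) :
    1 ≤ ∑ i, w i * (f i * g i) ^ k := by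
  classical
  set s := f i₀
  set t := g i₀
  have hs : 1 ≤ s := by
    rw [← hf1, ← one_mul s, ← hw1, Finset.sum_mul]
    exact Finset.sum_le_sum fun i _ => mul_le_mul_of_nonneg_left (hfm i) (hw i)
  have ht : 1 ≤ t := by
    rw [← hg1, ← one_mul t, ← hw1, Finset.sum_mul]
    exact Finset.sum_le_sum fun i _ => mul_le_mul_of_nonneg_left (hgm i) (hw i)
  have hst : 1 ≤ s * t := by nlinarith
  have hcov : s + t - s * t ≤ ∑ i, w i * (f i * g i) := by
    have h : ∑ i, w i * (s * g i + t * f i - s * t) ≤ ∑ i, w i * (f i * g i) :=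
      Finset.sum_le_sum fun i _ => mul_le_mul_of_nonneg_left
        (by nlinarith [mul_nonneg (sub_nonneg.2 (hfm i)) (sub_nonneg.2 (hgm i))]) (hw i)
    have e : ∑ i, w i * (s * g i + t * f i - s * t)
        = s * ∑ i, w i * g i + t * ∑ i, w i * f i - s * t * ∑ i, w i := by
      simp only [Finset.mul_sum, ← Finset.sum_add_distrib, ← Finset.sum_sub_distrib]
      exact Finset.sum_congr rfl fun i _ => by ring
    rw [e, hf1, hg1, hw1] at h
    linarith
  have hbern : ∀ i, 1 + k * (f i * g i - 1)
      + (if i = i₀ then k * (k - 1) / 2 * (s * t - 1) ^ 2 else 0) ≤ (f i * g i) ^ k := by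
    intro i
    split_ifs with h
    · subst h
      have := one_add_mul_add_sq_le_pow (sub_nonneg.2 hst) k
      rwa [add_sub_cancel] at this
    · have := one_add_mul_le_pow (a := f i * g i - 1)
        (by nlinarith [mul_nonneg (hf i) (hg i)]) k
      rw [add_sub_cancel] at this
      linarith
  have hsum := Finset.sum_le_sum fun i (_ : i ∈ Finset.univ) =>
    mul_le_mul_of_nonneg_left (hbern i) (hw i)
  have e : ∑ i, w i * (1 + k * (f i * g i - 1)
      + (if i = i₀ then k * (k - 1) / 2 * (s * t - 1) ^ 2 else 0))
      = ∑ i, w i + k * (∑ i, w i * (f i * g i) - ∑ i, w i)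
        + w i₀ * (k * (k - 1) / 2 * (s * t - 1) ^ 2) := by
    simp only [mul_add, Finset.sum_add_distrib, mul_ite, mul_zero, Finset.sum_ite_eq',
      Finset.mem_univ, if_true, mul_one, ← Finset.sum_sub_distrib, Finset.mul_sum]
    congr 2
    exact Finset.sum_congr rfl fun i _ => by ring
  rw [e, hw1] at hsum
  have hsq : 4 * ((s - 1) * (t - 1)) ≤ (s * t - 1) ^ 2 := by
    have h0 : 0 ≤ (s - 1) * (t - 1) := mul_nonneg (by linarith) (by linarith)
    have h1 : (s - 1) + (t - 1) ≤ s * t - 1 := by linarith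
    have h2 := pow_le_pow_left₀ (by linarith) h1 2
    nlinarith [sq_nonneg (s - t)]
  have hk0 : (0 : ℝ) ≤ k := k.cast_nonneg
  have hA : -((s - 1) * (t - 1)) ≤ ∑ i, w i * (f i * g i) - 1 := by linarith
  have hB := mul_le_mul_of_nonneg_left hA hk0
  have hC : 1 * (k * (s * t - 1) ^ 2) ≤ 2 * w i₀ * (k - 1) * (k * (s * t - 1) ^ 2) :=
    mul_le_mul_of_nonneg_right hk (by positivity)
  have hD := mul_le_mul_of_nonneg_left hsq hk0
  nlinarith

theorem mul_pow_le_sum_mul_mul_pow (hw : ∀ i, 0 ≤ w i) (hw1 : ∑ i, w i = 1)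
    (hk : 1 ≤ 2 * w i₀ * (k - 1)) (hf : ∀ i, 0 ≤ f i) (hg : ∀ i, 0 ≤ g i)
    (hfm : ∀ i, f i ≤ f i₀) (hgm : ∀ i, g i ≤ g i₀) :
    ((∑ i, w i * f i) * ∑ i, w i * g i) ^ k ≤ ∑ i, w i * (f i * g i) ^ k := by
  have hk0 : k ≠ 0 := by
    rintro rfl
    have := hw i₀
    norm_num at hk
    linarith
  have hR : 0 ≤ ∑ i, w i * (f i * g i) ^ k := Finset.sum_nonneg fun i _ =>
    mul_nonneg (hw i) (pow_nonneg (mul_nonneg (hf i) (hg i)) k)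
  set a := ∑ i, w i * f i
  set b := ∑ i, w i * g i
  have ha0 : 0 ≤ a := Finset.sum_nonneg fun i _ => mul_nonneg (hw i) (hf i)
  have hb0 : 0 ≤ b := Finset.sum_nonneg fun i _ => mul_nonneg (hw i) (hg i)
  rcases ha0.eq_or_lt with h | ha0
  · rwa [← h, zero_mul, zero_pow hk0]
  rcases hb0.eq_or_lt with h | hb0
  · rwa [← h, mul_zero, zero_pow hk0]
  have key := one_le_sum_mul_mul_pow (f := fun i => f i / a) (g := fun i => g i / b) hw hw1 hk
    (fun i => div_nonneg (hf i) ha0.le) (fun i => div_nonneg (hg i) hb0.le)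
    (fun i => by simpa using div_le_div_of_nonneg_right (hfm i) ha0.le)
    (fun i => by simpa using div_le_div_of_nonneg_right (hgm i) hb0.le)
    (by simp only [← mul_div_assoc, ← Finset.sum_div]; exact div_self ha0.ne')
    (by simp only [← mul_div_assoc, ← Finset.sum_div]; exact div_self hb0.ne')
  simp only [div_mul_div_comm, div_pow] at key
  simp only [← mul_div_assoc, ← Finset.sum_div] at key
  rwa [one_le_div (by positivity)] at key

end WeightedSums

section Sequences

variable {P : Type*}

/-- Prepend a term to a sequence. -/
def consSeq (x : P) (ω : ℕ → P) : ℕ → P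
  | 0 => x
  | n + 1 => ω n

theorem measurable_consSeq [MeasurableSpace P] (x : P) : Measurable (consSeq x) := by
  refine measurable_pi_iff.2 fun i => ?_
  cases i with
  | zero => exact measurable_const
  | succ n => exact measurable_pi_apply n

theorem consSeq_mono [Preorder P] {x y : P} (hxy : x ≤ y) {ω ω' : ℕ → P} (h : ω ≤ ω') :
    consSeq x ω ≤ consSeq y ω' := by
  intro i
  cases i with
  | zero => exact hxy
  | succ n => exact h n

theorem isPiSystem_finset_cylinders :
    IsPiSystem {E : Set (ℕ → P) | ∃ (s : Finset ℕ) (f : ℕ → P), {ω | ∀ i ∈ s, ω i = f i} = E} := by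
  rintro _ ⟨s, f, rfl⟩ _ ⟨t, g, rfl⟩ ⟨η, hη⟩
  refine ⟨s ∪ t, η, ?_⟩
  ext ω
  simp only [Set.mem_ofPred_eq, Set.mem_inter_iff, Finset.mem_union] at hη ⊢
  constructor
  · exact fun h => ⟨fun i hi => (h i (.inl hi)).trans (hη.1 i hi),
      fun i hi => (h i (.inr hi)).trans (hη.2 i hi)⟩
  · rintro ⟨h1, h2⟩ i (hi | hi)
    · exact (h1 i hi).trans (hη.1 i hi).symm
    · exact (h2 i hi).trans (hη.2 i hi).symm

theorem generateFrom_finset_cylinders [Countable P] [MeasurableSpace P]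
    [DiscreteMeasurableSpace P] :
    MeasurableSpace.generateFrom
      {E : Set (ℕ → P) | ∃ (s : Finset ℕ) (f : ℕ → P), {ω | ∀ i ∈ s, ω i = f i} = E}
      = MeasurableSpace.pi := by
  apply le_antisymm
  · refine MeasurableSpace.generateFrom_le ?_
    rintro _ ⟨s, f, rfl⟩
    have : {ω : ℕ → P | ∀ i ∈ s, ω i = f i} = ⋂ i ∈ s, (fun ω => ω i) ⁻¹' {f i} := by
      ext; simp
    rw [this]
    exact s.measurableSet_biInter fun i _ => measurable_pi_apply i (MeasurableSet.singleton _)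
  · refine iSup_le fun i => ?_
    rintro _ ⟨T, -, rfl⟩
    have : (fun ω : ℕ → P => ω i) ⁻¹' T = ⋃ x ∈ T, {ω | ∀ j ∈ ({i} : Finset ℕ), ω j = x} := by
      ext; simp
    rw [this]
    exact MeasurableSet.biUnion T.to_countable fun x _ =>
      MeasurableSpace.measurableSet_generateFrom ⟨{i}, fun _ => x, rfl⟩

theorem consSeq_preimage_cylinder (x : P) (s : Finset ℕ) (f : ℕ → P) :
    consSeq x ⁻¹' {ω | ∀ i ∈ s, ω i = f i}
      = {ω | (0 ∈ s → x = f 0) ∧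
          ∀ i ∈ s.preimage Nat.succ Nat.succ_injective.injOn, ω i = f (i + 1)} := by
  ext ω
  simp only [Set.mem_preimage, Set.mem_ofPred_eq, Finset.mem_preimage]
  constructor
  · exact fun h => ⟨h 0, fun i hi => h _ hi⟩
  · rintro ⟨h0, h⟩ (_ | i) hi
    · exact h0 hi
    · exact h i hi

variable [Fintype P] [MeasurableSpace P] [DiscreteMeasurableSpace P] {μ : P → ℝ}
  {M : Measure (ℕ → P)} [IsProbabilityMeasure M]

theorem sum_smul_map_consSeq_eq (hμ0 : ∀ x, 0 ≤ μ x) (hμ1 : ∑ x : P, μ x = 1)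
    (hcyl : ∀ (s : Finset ℕ) (f : ℕ → P),
      M {ω | ∀ i ∈ s, ω i = f i} = ∏ i ∈ s, ENNReal.ofReal (μ (f i))) :
    M = ∑ x, ENNReal.ofReal (μ x) • M.map (consSeq x) := by
  classical
  have hμ1' : ∑ x, ENNReal.ofReal (μ x) = 1 := by
    rw [← ENNReal.ofReal_sum_of_nonneg fun x _ => hμ0 x, hμ1, ENNReal.ofReal_one]
  refine ext_of_generate_finite _ generateFrom_finset_cylinders.symm isPiSystem_finset_cylinders
    ?_ ?_
  · rintro _ ⟨s, f, rfl⟩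
    have hmeas : MeasurableSet {ω : ℕ → P | ∀ i ∈ s, ω i = f i} := by
      rw [← generateFrom_finset_cylinders]
      exact MeasurableSpace.measurableSet_generateFrom ⟨s, f, rfl⟩
    set s' := s.preimage Nat.succ Nat.succ_injective.injOn with hs'
    have hprod : ∏ i ∈ s, ENNReal.ofReal (μ (f i))
        = (if 0 ∈ s then ENNReal.ofReal (μ (f 0)) else 1)
          * ∏ i ∈ s', ENNReal.ofReal (μ (f (i + 1))) := by
      have hs0 : s.erase 0 = s'.map ⟨Nat.succ, Nat.succ_injective⟩ := by
        ext i
        cases i <;> simp [hs']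
      split_ifs with h0
      · rw [← Finset.mul_prod_erase s _ h0, hs0, Finset.prod_map]
        rfl
      · rw [← Finset.erase_eq_of_notMem h0, hs0, Finset.prod_map, one_mul]
        rfl
    have hsec : ∀ x, M (consSeq x ⁻¹' {ω | ∀ i ∈ s, ω i = f i})
        = if 0 ∈ s → x = f 0 then ∏ i ∈ s', ENNReal.ofReal (μ (f (i + 1))) else 0 := by
      intro x
      rw [consSeq_preimage_cylinder]
      split_ifs with h
      · rw [← hcyl s' fun i => f (i + 1)]
        exact congrArg M (Set.ext fun ω => and_iff_right h)
      · simp only [h, false_and, Set.ofPred_false, measure_empty]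
    rw [hcyl, hprod]
    simp only [Measure.coe_finsetSum, Finset.sum_apply, Measure.smul_apply, smul_eq_mul,
      Measure.map_apply (measurable_consSeq _) hmeas, hsec]
    by_cases h0 : 0 ∈ s
    · simp [h0]
    · simp [h0, ← Finset.sum_mul, hμ1']
  · simp [Measure.map_apply (measurable_consSeq _) MeasurableSet.univ, hμ1']

theorem measureReal_eq_sum_consSeq (hμ0 : ∀ x, 0 ≤ μ x) (hμ1 : ∑ x : P, μ x = 1)
    (hcyl : ∀ (s : Finset ℕ) (f : ℕ → P),
      M {ω | ∀ i ∈ s, ω i = f i} = ∏ i ∈ s, ENNReal.ofReal (μ (f i)))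
    {E : Set (ℕ → P)} (hE : MeasurableSet E) :
    M.real E = ∑ x, μ x * M.real (consSeq x ⁻¹' E) := by
  have h : M E = ∑ x, ENNReal.ofReal (μ x) * M (consSeq x ⁻¹' E) := by
    conv_lhs => rw [sum_smul_map_consSeq_eq hμ0 hμ1 hcyl]
    simp [Measure.map_apply (measurable_consSeq _) hE]
  rw [measureReal_def, h, ENNReal.toReal_sum fun x _ =>
    ENNReal.mul_ne_top ENNReal.ofReal_ne_top (measure_ne_top _ _)]
  simp [measureReal_def, ENNReal.toReal_ofReal (hμ0 _)]

open scoped symmDiff in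
theorem mul_pow_le_measureReal_inter_add_symmDiff [PartialOrder P]
    {x₀ : P} (hx₀ : ∀ x : P, x ≤ x₀)
    (hμ0 : ∀ x, 0 ≤ μ x) (hμ1 : ∑ x : P, μ x = 1) {k : ℕ} (hk : 1 ≤ 2 * μ x₀ * (k - 1))
    (hcyl : ∀ (s : Finset ℕ) (f : ℕ → P),
      M {ω | ∀ i ∈ s, ω i = f i} = ∏ i ∈ s, ENNReal.ofReal (μ (f i)))
    (n : ℕ) {A B C : Set (ℕ → P)} (hA : MeasurableSet A) (hB : MeasurableSet B)
    (hC : MeasurableSet C) (hAu : IsUpperSet A) (hBu : IsUpperSet B)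
    (hCn : DependsOn (· ∈ C) (Set.Iio n)) :
    (M.real A * M.real B) ^ k ≤ M.real (C ∩ B) + M.real (A ∆ C) := by
  induction n generalizing A B C with
  | zero =>
    have hk0 : k ≠ 0 := by
      rintro rfl
      have := hμ0 x₀
      norm_num at hk
      linarith
    have hpow : (M.real A * M.real B) ^ k ≤ M.real A * M.real B :=
      pow_le_of_le_one (by positivity)
        (mul_le_one₀ measureReal_le_one measureReal_nonneg measureReal_le_one) hk0
    rcases C.eq_empty_or_nonempty with rfl | ⟨ω, hω⟩
    · have : M.real A * M.real B ≤ M.real A :=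
        mul_le_of_le_one_right measureReal_nonneg measureReal_le_one
      have hAe : A ∆ ∅ = A := symmDiff_bot A
      rw [Set.empty_inter, measureReal_empty, zero_add, hAe]
      exact hpow.trans this
    · have : C = Set.univ := Set.eq_univ_of_forall fun η => by
        have := hCn (x := ω) (y := η) (by simp)
        exact this.mp hω
      have h2 : M.real A * M.real B ≤ M.real B :=
        mul_le_of_le_one_left measureReal_nonneg measureReal_le_one
      rw [this, Set.univ_inter]
      linarith [measureReal_nonneg (μ := M) (s := A ∆ Set.univ)]
  | succ n ih =>
    have hsec : ∀ {U : Set (ℕ → P)}, IsUpperSet U → ∀ x, consSeq x ⁻¹' U ⊆ consSeq x₀ ⁻¹' U :=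
      fun hU x ω h => hU (consSeq_mono (hx₀ x) le_rfl) h
    rw [measureReal_eq_sum_consSeq hμ0 hμ1 hcyl hA, measureReal_eq_sum_consSeq hμ0 hμ1 hcyl hB,
      measureReal_eq_sum_consSeq hμ0 hμ1 hcyl (hC.inter hB),
      measureReal_eq_sum_consSeq hμ0 hμ1 hcyl (hA.symmDiff hC), ← Finset.sum_add_distrib]
    refine (mul_pow_le_sum_mul_mul_pow hμ0 hμ1 hk (fun _ => measureReal_nonneg)
      (fun _ => measureReal_nonneg) (fun x => measureReal_mono (hsec hAu x))
      (fun x => measureReal_mono (hsec hBu x))).trans ?_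
    refine Finset.sum_le_sum fun x _ => ?_
    rw [← mul_add]
    refine mul_le_mul_of_nonneg_left ?_ (hμ0 x)
    refine ih (measurable_consSeq x hA) (measurable_consSeq x hB) (measurable_consSeq x hC)
      (fun _ _ h => hAu (consSeq_mono le_rfl h)) (fun _ _ h => hBu (consSeq_mono le_rfl h)) ?_
    intro ω η h
    refine hCn ?_
    rintro (_ | i) hi
    · rfl
    · exact h i (Nat.lt_of_succ_lt_succ hi)

open scoped symmDiff in
theorem mul_pow_le_measureReal_inter [PartialOrder P] {x₀ : P} (hx₀ : ∀ x : P, x ≤ x₀)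
    (hμ0 : ∀ x, 0 ≤ μ x) (hμ1 : ∑ x : P, μ x = 1) {k : ℕ} (hk : 1 ≤ 2 * μ x₀ * (k - 1))
    (hcyl : ∀ (s : Finset ℕ) (f : ℕ → P),
      M {ω | ∀ i ∈ s, ω i = f i} = ∏ i ∈ s, ENNReal.ofReal (μ (f i)))
    {A B : Set (ℕ → P)} (hA : MeasurableSet A) (hB : MeasurableSet B)
    (hAu : IsUpperSet A) (hBu : IsUpperSet B) :
    (M.real A * M.real B) ^ k ≤ M.real (A ∩ B) := by
  refine le_of_forall_pos_le_add fun ε hε => ?_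
  obtain ⟨C, hC, hAC⟩ := exists_measure_symmDiff_lt_of_generateFrom_isSetRing (μ := M)
    isSetAlgebra_measurableCylinders.isSetRing
    ⟨{Set.univ}, by simp, by simpa only [Set.singleton_subset_iff] using
      univ_mem_measurableCylinders fun _ : ℕ => P, by simp⟩
    generateFrom_measurableCylinders.symm hA (ε := ENNReal.ofReal (ε / 2)) (by simpa using hε)
  have hCm := MeasurableSet.of_mem_measurableCylinders hC
  obtain ⟨s, S, -, rfl⟩ := (mem_measurableCylinders _).1 hC
  have hCn : DependsOn (· ∈ cylinder (α := fun _ => P) s S) (Set.Iio (s.sup id + 1)) := by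
    intro ω η h
    have : s.restrict ω = s.restrict η := funext fun i =>
      h i (Nat.lt_succ_of_le (Finset.le_sup (f := id) i.2))
    simp only [mem_cylinder, this]
  have key := mul_pow_le_measureReal_inter_add_symmDiff hx₀ hμ0 hμ1 hk hcyl _ hA hB hCm hAu hBu hCn
  have hsub : cylinder (α := fun _ => P) s S ∩ B ⊆ (A ∩ B) ∪ A ∆ cylinder (α := fun _ => P) s S := by
    rintro ω ⟨h1, h2⟩
    by_cases h : ω ∈ A
    · exact .inl ⟨h, h2⟩
    · exact .inr (.inr ⟨h1, h⟩)
  have h1 := (measureReal_mono (μ := M) hsub).trans (measureReal_union_le _ _)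
  have h2 : M.real (A ∆ cylinder (α := fun _ => P) s S) < ε / 2 := by
    rw [symmDiff_comm]
    exact ENNReal.toReal_lt_of_lt_ofReal hAC
  linarith

end Sequences



/-- **Abstract generalized Harris lemma for infinite products**: for a finite
poset `P` with greatest element `x₀` of positive probability `μ(x₀)`, there is
a function `F : (0,1]² → (0,1]`, strictly increasing in each argument, such
that for the product measure `μ^ℕ` on `P^ℕ` and any measurable upsets `A`, `B`
of positive measure, `μ^ℕ(A ∩ B) ≥ F(μ^ℕ(A), μ^ℕ(B))`. -/
theorem abstract_generalized_harris_infinite (P : Type) [Fintype P] [PartialOrder P]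
    [MeasurableSpace P] [DiscreteMeasurableSpace P]
    (x0 : P) (hx0 : ∀ x : P, x ≤ x0)
    (μ : P → ℝ) (hμ0 : ∀ x, 0 ≤ μ x) (hμ1 : ∑ x : P, μ x = 1) (hpos : 0 < μ x0)
    (M : Measure (ℕ → P)) (hM : IsProbabilityMeasure M)
    (hcyl : ∀ (s : Finset ℕ) (f : ℕ → P),
      M {ω | ∀ i ∈ s, ω i = f i} = ∏ i ∈ s, ENNReal.ofReal (μ (f i))) :
    ∃ F : ℝ → ℝ → ℝ,
      (∀ a ∈ Set.Ioc (0 : ℝ) 1, ∀ b ∈ Set.Ioc (0 : ℝ) 1, F a b ∈ Set.Ioc (0 : ℝ) 1) ∧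
      (∀ b ∈ Set.Ioc (0 : ℝ) 1, StrictMonoOn (fun a => F a b) (Set.Ioc (0 : ℝ) 1)) ∧
      (∀ a ∈ Set.Ioc (0 : ℝ) 1, StrictMonoOn (fun b => F a b) (Set.Ioc (0 : ℝ) 1)) ∧
      ∀ A B : Set (ℕ → P), MeasurableSet A → MeasurableSet B →
        IsUpperSet A → IsUpperSet B → 0 < M A → 0 < M B →
        ENNReal.ofReal (F (M A).toReal (M B).toReal) ≤ M (A ∩ B) := by
  obtain ⟨m, hm⟩ := exists_nat_gt (1 / (2 * μ x0))
  have hk : 1 ≤ 2 * μ x0 * (((m + 1 : ℕ) : ℝ) - 1) := by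
    rw [div_lt_iff₀ (by positivity)] at hm
    push_cast
    linarith
  refine ⟨fun a b => (a * b) ^ (m + 1), ?_, ?_, ?_, ?_⟩
  · rintro a ⟨ha0, ha1⟩ b ⟨hb0, hb1⟩
    exact ⟨by positivity, pow_le_one₀ (by positivity) (mul_le_one₀ ha1 hb0.le hb1)⟩
  · rintro b ⟨hb0, -⟩ a ⟨ha0, -⟩ a' - h
    exact pow_lt_pow_left₀ (mul_lt_mul_of_pos_right h hb0) (by positivity) m.succ_ne_zero
  · rintro a ⟨ha0, -⟩ b ⟨hb0, -⟩ b' - h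
    exact pow_lt_pow_left₀ (mul_lt_mul_of_pos_left h ha0) (by positivity) m.succ_ne_zero
  · intro A B hA hB hAu hBu _ _
    exact (ENNReal.ofReal_le_iff_le_toReal (measure_ne_top M _)).2
      (mul_pow_le_measureReal_inter hx0 hμ0 hμ1 hk hcyl hA hB hAu hBu)
end
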